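/- arXiv:1301.3335 — 4 statements merged into one kernel-verified Lean document; each statement's English description precedes it below -/
import Mathlib

section
/- (Quantitative minimality, Lemma 3.7.) Let K₁, K₂ ⊆ ℝⁿ be compact and assume Γ^min_{K₁,K₂} is nonempty. Then there exists a continuous function ω : [0,∞) → ℝ with ω(0) = 0 and ω(s) > 0 for all s > 0 such that for every γ ∈ C([a,b];ℝⁿ) with γ(a) ∈ K₁ and γ(b) ∈ K₂ one has 𝒜(γ) ≥ c(γ(a),γ(b)) + ω(dist(γ, Γ^min_{K₁,K₂})), where dist(γ, S) := inf_{σ∈S} d_Γ(γ,σ). -/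
open MeasureTheory Filter Topology
open scoped ENNReal NNReal

noncomputable section

/-- Euclidean space `ℝⁿ`. -/
abbrev Eu (n : ℕ) := EuclideanSpace ℝ (Fin n)

/-- The space `C([a,b];ℝⁿ)` of continuous curves with the supremum metric. -/
abbrev CPath (a b : ℝ) (n : ℕ) := C(Set.Icc a b, Eu n)

/-- We endow the path space with its Borel σ-algebra. -/
noncomputable instance pathMeasurableSpace (a b : ℝ) (n : ℕ) :
    MeasurableSpace (CPath a b n) := borel _

instance pathBorelSpace (a b : ℝ) (n : ℕ) : BorelSpace (CPath a b n) :=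
  ⟨rfl⟩

/-- Evaluation of a curve at time `t ∈ [a,b]` (junk value `0` outside `[a,b]`). -/
def pev {a b : ℝ} {n : ℕ} (γ : CPath a b n) (t : ℝ) : Eu n :=
  if ht : t ∈ Set.Icc a b then γ ⟨t, ht⟩ else 0

/-- A curve is absolutely continuous if it has a Bochner-integrable derivative `g` with
`γ t = γ s + ∫_s^t g`. -/
def IsACC {a b : ℝ} {n : ℕ} (γ : CPath a b n) : Prop :=
  ∃ g : ℝ → Eu n, IntegrableOn g (Set.Icc a b) ∧
    ∀ s t : Set.Icc a b, γ t = γ s + ∫ u in (s : ℝ)..(t : ℝ), g u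

open Classical in
/-- The action `𝒜(γ) = ∫_a^b L(γ(t), γ̇(t)) dt ∈ (−∞,+∞]`, equal to `+∞` on curves that are
not absolutely continuous (and, by the convention that the integral is `+∞` when the
integrand fails to be integrable -- its negative part being automatically integrable --
also on absolutely continuous curves with non-integrable Lagrangian). -/
def action {n : ℕ} (L : Eu n → Eu n → ℝ) (a b : ℝ) (γ : CPath a b n) : EReal :=
  if h : IsACC γ then
    (if IntegrableOn (fun t => L (pev γ t) (h.choose t)) (Set.Icc a b) then
      (((∫ t in Set.Icc a b, L (pev γ t) (h.choose t)) : ℝ) : EReal)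
    else ⊤)
  else ⊤

/-- Positive part of an extended real, as `ℝ≥0∞`. -/
def epos (x : EReal) : ℝ≥0∞ := if x = ⊤ then ⊤ else ENNReal.ofReal x.toReal

/-- The integral `∫ F dπ ∈ [−∞,+∞]` of an extended-real-valued function, defined as the
difference of the lower integrals of the positive and negative parts. -/
def mint {X : Type*} [MeasurableSpace X] (F : X → EReal) (π : Measure X) : EReal :=
  ((∫⁻ γ, epos (F γ) ∂π : ℝ≥0∞) : EReal) - ((∫⁻ γ, epos (-(F γ)) ∂π : ℝ≥0∞) : EReal)

open Classical in
/-- The constrained functional `𝔸_{μa,μb}(π) = ∫ 𝒜 dπ` if `pr_a#π = μa` and `pr_b#π = μb`,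
and `+∞` otherwise, for a given (extended-real-valued) action functional `F`. -/
def aFun {a b : ℝ} {n : ℕ} (F : CPath a b n → EReal) (μa μb : Measure (Eu n))
    (π : Measure (CPath a b n)) : EReal :=
  if Measure.map (fun γ => pev γ a) π = μa ∧ Measure.map (fun γ => pev γ b) π = μb then
    mint F π
  else ⊤

/-- Weak convergence of a sequence of measures: convergence of the integrals of all bounded
continuous functions. -/
def WeakLim {X : Type*} [TopologicalSpace X] [MeasurableSpace X]
    (πs : ℕ → Measure X) (π : Measure X) : Prop :=
  ∀ φ : BoundedContinuousFunction X ℝ,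
    Tendsto (fun N => ∫ x, φ x ∂(πs N)) atTop (𝓝 (∫ x, φ x ∂π))

/-- The empirical measure `(1/N) ∑_{i=1}^N δ_{x i}`. -/
def emp {X : Type*} [MeasurableSpace X] (N : ℕ) (x : Fin N → X) : Measure X :=
  (N : ℝ≥0∞)⁻¹ • ∑ i : Fin N, Measure.dirac (x i)

/-- The topological support of a measure. -/
def msupp {α : Type*} [TopologicalSpace α] [MeasurableSpace α] (μ : Measure α) : Set α :=
  {x | ∀ U : Set α, IsOpen U → x ∈ U → 0 < μ U}

/-- The set `Γ^min_{K₁,K₂}` of minimizing extremals starting in `K₁` and ending in `K₂`. -/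
def GammaMin {n : ℕ} (L : Eu n → Eu n → ℝ) (a b : ℝ) (K₁ K₂ : Set (Eu n)) :
    Set (CPath a b n) :=
  {γ | IsACC γ ∧ pev γ a ∈ K₁ ∧ pev γ b ∈ K₂ ∧
    ∀ γ' : CPath a b n, IsACC γ' → pev γ' a = pev γ a → pev γ' b = pev γ b →
      action L a b γ ≤ action L a b γ'}

/-- The Lagrangian cost `c(x,y)`: the minimal action among absolutely continuous curves
from `x` to `y`. -/
def cost {n : ℕ} (L : Eu n → Eu n → ℝ) (a b : ℝ) (x y : Eu n) : EReal :=
  ⨅ γ ∈ {γ : CPath a b n | IsACC γ ∧ pev γ a = x ∧ pev γ b = y}, action L a b γ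

/-- The restriction of a continuous curve `ℝ → ℝⁿ` to `[a,b]` as an element of the path
space. -/
def toPath {n : ℕ} (a b : ℝ) (f : ℝ → Eu n) (hf : Continuous f) : CPath a b n :=
  (ContinuousMap.mk f hf).restrict (Set.Icc a b)

/-- `Φ : ℝⁿ × ℝⁿ → C([a,b];ℝⁿ)` is the Euler–Lagrange (Newton) flow map for the Lagrangian
`L(x,v) = (m/2)|v|² − V(x)`: it is continuous and `Φ(x,v)` is a `C²` solution of
`m γ'' = −∇V(γ)` with initial position `x` and initial velocity `v`. -/
def IsNewtonFlow {n : ℕ} (m : ℝ) (V : Eu n → ℝ) (a b : ℝ)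
    (Φ : Eu n × Eu n → CPath a b n) : Prop :=
  Continuous Φ ∧ ∀ x v : Eu n, ∃ f : ℝ → Eu n, ContDiff ℝ 2 f ∧
    (∀ t : Set.Icc a b, Φ (x, v) t = f t) ∧ f a = x ∧ deriv f a = v ∧
    ∀ t ∈ Set.Icc a b, m • deriv (deriv f) t = -gradient V (f t)

/-- The set of `C²` solutions of `m γ'' = −∇V(γ)` starting in `Ka` and ending in `Kb`,
viewed as a subset of the path space. -/
def NewtonSet {n : ℕ} (m : ℝ) (V : Eu n → ℝ) (a b : ℝ) (Ka Kb : Set (Eu n)) :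
    Set (CPath a b n) :=
  {γ | ∃ f : ℝ → Eu n, ContDiff ℝ 2 f ∧ (∀ t : Set.Icc a b, γ t = f t) ∧
    (∀ t ∈ Set.Icc a b, m • deriv (deriv f) t = -gradient V (f t)) ∧
    f a ∈ Ka ∧ f b ∈ Kb}

/-- `γ` is piecewise affine subordinate to the partition `a = τ₀ < … < τ_l = b`. -/
def PiecewiseAffine {n : ℕ} (a b : ℝ) (τ : ℕ → ℝ) (l : ℕ) (γ : CPath a b n) : Prop :=
  ∀ j < l, ∀ t : Set.Icc a b, (t : ℝ) ∈ Set.Icc (τ j) (τ (j + 1)) →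
    γ t = pev γ (τ j) + (((t : ℝ) - τ j) / (τ (j + 1) - τ j)) •
      (pev γ (τ (j + 1)) - pev γ (τ j))

/-- `IsPartition a b τ l h`: `a = τ₀ < τ₁ < … < τ_l = b` is a partition of `[a,b]` of mesh
at most `h`. -/
def IsPartition (a b : ℝ) (τ : ℕ → ℝ) (l : ℕ) (h : ℝ) : Prop :=
  1 ≤ l ∧ τ 0 = a ∧ τ l = b ∧ (∀ j < l, τ j < τ (j + 1)) ∧
    ∀ j < l, τ (j + 1) - τ j ≤ h

/-- The midpoint-rule discrete action, as a (real-valued) sum over the first `l` intervals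
of the partition. -/
def dActionSum {n : ℕ} (m : ℝ) (V : Eu n → ℝ) {a b : ℝ} (τ : ℕ → ℝ) (l : ℕ)
    (γ : CPath a b n) : ℝ :=
  ∑ j ∈ Finset.range l,
    (m / 2 * ‖pev γ (τ (j + 1)) - pev γ (τ j)‖ ^ 2 / (τ (j + 1) - τ j) -
      V ((2 : ℝ)⁻¹ • (pev γ (τ (j + 1)) + pev γ (τ j))) * (τ (j + 1) - τ j))

open Classical in
/-- The discrete action `𝒜^{[h]}`: the midpoint-rule discrete action for piecewise affine
curves subordinate to the partition, `+∞` otherwise. -/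
def dAction {n : ℕ} (m : ℝ) (V : Eu n → ℝ) (a b : ℝ) (τ : ℕ → ℝ) (l : ℕ)
    (γ : CPath a b n) : EReal :=
  if PiecewiseAffine a b τ l γ then ((dActionSum m V τ l γ : ℝ) : EReal) else ⊤

/-- The discrete Euler–Lagrange equations for a piecewise affine curve subordinate to the
partition `a = τ₀ < … < τ_l = b`. -/
def DiscreteEL {n : ℕ} (m : ℝ) (V : Eu n → ℝ) {a b : ℝ} (τ : ℕ → ℝ) (l : ℕ)
    (γ : CPath a b n) : Prop :=
  ∀ j, 1 ≤ j → j < l →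
    m • ((τ j - τ (j - 1))⁻¹ • (pev γ (τ j) - pev γ (τ (j - 1)))) -
      m • ((τ (j + 1) - τ j)⁻¹ • (pev γ (τ (j + 1)) - pev γ (τ j))) =
    ((τ j - τ (j - 1)) / 2) • gradient V ((2 : ℝ)⁻¹ • (pev γ (τ (j - 1)) + pev γ (τ j))) +
      ((τ (j + 1) - τ j) / 2) • gradient V ((2 : ℝ)⁻¹ • (pev γ (τ j) + pev γ (τ (j + 1))))

end

/-- `f` is absolutely continuous on `[s, t]` with derivative `g` and finite action `A`. -/
structure HasAction {n : ℕ} (L : Eu n → Eu n → ℝ) (s t : ℝ) (f g : ℝ → Eu n) (A : ℝ) : Prop where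
  le : s ≤ t
  integrable : IntervalIntegrable g volume s t
  eq_add_integral : ∀ r ∈ Set.Icc s t, f r = f s + ∫ u in s..r, g u
  integrable_lagrangian : IntervalIntegrable (fun r => L (f r) (g r)) volume s t
  integral_lagrangian : ∫ r in s..t, L (f r) (g r) = A

/-- Some absolutely continuous curve on `[s, t]` from `x` to `y` has action `A`. -/
def Joins {n : ℕ} (L : Eu n → Eu n → ℝ) (s t : ℝ) (x y : Eu n) (A : ℝ) : Prop :=
  ∃ f g : ℝ → Eu n, HasAction L s t f g A ∧ f s = x ∧ f t = y

section Curves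

variable {n : ℕ} {L : Eu n → Eu n → ℝ} {s t r : ℝ} {f g : ℝ → Eu n} {x y z : Eu n} {A B : ℝ}

lemma HasAction.sub_eq_integral (h : HasAction L s t f g A) {p q : ℝ} (hp : p ∈ Set.Icc s t)
    (hq : q ∈ Set.Icc s t) : f q - f p = ∫ u in p..q, g u := by
  rw [h.eq_add_integral p hp, h.eq_add_integral q hq, add_sub_add_left_eq_sub]
  apply intervalIntegral.integral_interval_sub_left
  · exact h.integrable.mono_set (by
      rw [Set.uIcc_of_le h.le, Set.uIcc_of_le hq.1]; exact Set.Icc_subset_Icc le_rfl hq.2)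
  · exact h.integrable.mono_set (by
      rw [Set.uIcc_of_le h.le, Set.uIcc_of_le hp.1]; exact Set.Icc_subset_Icc le_rfl hp.2)

lemma HasAction.continuousOn (h : HasAction L s t f g A) : ContinuousOn f (Set.Icc s t) := by
  have h1 : ContinuousOn (fun r => f s + ∫ u in s..r, g u) (Set.Icc s t) := by
    have := intervalIntegral.continuousOn_primitive_interval (μ := volume) (f := g) (a := s) (b := t)
      (by rw [Set.uIcc_of_le h.le, ← intervalIntegrable_iff_integrableOn_Icc_of_le h.le]
          exact h.integrable)
    rw [Set.uIcc_of_le h.le] at this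
    exact continuousOn_const.add this
  exact h1.congr fun r hr => h.eq_add_integral r hr

lemma HasAction.restrict (h : HasAction L s t f g A) {p q : ℝ} (hp : p ∈ Set.Icc s t)
    (hq : q ∈ Set.Icc s t) (hpq : p ≤ q) :
    HasAction L p q f g (∫ u in p..q, L (f u) (g u)) := by
  have hsub : Set.uIcc p q ⊆ Set.uIcc s t := by
    rw [Set.uIcc_of_le h.le, Set.uIcc_of_le hpq]; exact Set.Icc_subset_Icc hp.1 hq.2
  refine ⟨hpq, h.integrable.mono_set hsub, fun r hr => ?_, h.integrable_lagrangian.mono_set hsub,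
    rfl⟩
  rw [← h.sub_eq_integral hp ⟨hp.1.trans hr.1, hr.2.trans hq.2⟩]
  abel

lemma HasAction.congr (h : HasAction L s t f g A) {f' g' : ℝ → Eu n}
    (hf : ∀ r ∈ Set.Icc s t, f' r = f r) (hg : ∀ r ∈ Set.Ioc s t, g' r = g r) :
    HasAction L s t f' g' A := by
  have hfg : ∀ r ∈ Set.Ioc s t, L (f' r) (g' r) = L (f r) (g r) := fun r hr => by
    rw [hf r (Set.Ioc_subset_Icc_self hr), hg r hr]
  refine ⟨h.le, h.integrable.congr ?_, fun r hr => ?_, h.integrable_lagrangian.congr ?_, ?_⟩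
  · intro r hr
    rw [Set.uIoc_of_le h.le] at hr
    exact (hg r hr).symm
  · rw [hf r hr, hf s (Set.left_mem_Icc.2 h.le), h.eq_add_integral r hr]
    congr 1
    refine intervalIntegral.integral_congr_ae (ae_of_all _ fun u hu => ?_)
    rw [Set.uIoc_of_le hr.1] at hu
    exact (hg u ⟨hu.1, hu.2.trans hr.2⟩).symm
  · intro r hr
    rw [Set.uIoc_of_le h.le] at hr
    exact (hfg r hr).symm
  · rw [← h.integral_lagrangian]
    refine intervalIntegral.integral_congr_ae (ae_of_all _ fun u hu => ?_)
    rw [Set.uIoc_of_le h.le] at hu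
    exact hfg u hu

lemma HasAction.shift (h : HasAction L s t f g A) (d : ℝ) :
    HasAction L (s + d) (t + d) (fun r => f (r - d)) (fun r => g (r - d)) A := by
  refine ⟨by linarith [h.le], h.integrable.comp_sub_right d, fun r hr => ?_,
    h.integrable_lagrangian.comp_sub_right d, ?_⟩
  · rw [intervalIntegral.integral_comp_sub_right, add_sub_cancel_right]
    exact h.eq_add_integral _ ⟨by linarith [hr.1], by linarith [hr.2]⟩
  · rw [intervalIntegral.integral_comp_sub_right (fun r => L (f r) (g r)), add_sub_cancel_right,
      add_sub_cancel_right, h.integral_lagrangian]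

lemma HasAction.trans (h₁ : HasAction L s t f g A) (h₂ : HasAction L t r f g B) :
    HasAction L s r f g (A + B) := by
  refine ⟨h₁.le.trans h₂.le, h₁.integrable.trans h₂.integrable, fun q hq => ?_,
    h₁.integrable_lagrangian.trans h₂.integrable_lagrangian, ?_⟩
  · rcases le_total q t with hqt | hqt
    · exact h₁.eq_add_integral q ⟨hq.1, hqt⟩
    · rw [h₂.eq_add_integral q ⟨hqt, hq.2⟩, h₁.eq_add_integral t (Set.right_mem_Icc.2 h₁.le),
        add_assoc, intervalIntegral.integral_add_adjacent_intervals h₁.integrable]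
      exact h₂.integrable.mono_set (by
        rw [Set.uIcc_of_le h₂.le, Set.uIcc_of_le hqt]; exact Set.Icc_subset_Icc le_rfl hq.2)
  · rw [← intervalIntegral.integral_add_adjacent_intervals h₁.integrable_lagrangian
      h₂.integrable_lagrangian, h₁.integral_lagrangian, h₂.integral_lagrangian]

lemma HasAction.joins (h : HasAction L s t f g A) {p q : ℝ} (hp : p ∈ Set.Icc s t)
    (hq : q ∈ Set.Icc s t) (hpq : p ≤ q) :
    Joins L p q (f p) (f q) (∫ u in p..q, L (f u) (g u)) :=
  ⟨f, g, h.restrict hp hq hpq, rfl, rfl⟩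

lemma Joins.shift (h : Joins L s t x y A) (d : ℝ) : Joins L (s + d) (t + d) x y A := by
  obtain ⟨f, g, h, hs, ht⟩ := h
  exact ⟨_, _, h.shift d, by simpa using hs, by simpa using ht⟩

lemma Joins.trans (h₁ : Joins L s t x y A) (h₂ : Joins L t r y z B) :
    Joins L s r x z (A + B) := by
  obtain ⟨f₁, g₁, h₁, hs₁, ht₁⟩ := h₁
  obtain ⟨f₂, g₂, h₂, hs₂, ht₂⟩ := h₂
  refine ⟨fun q => if q ≤ t then f₁ q else f₂ q, fun q => if q ≤ t then g₁ q else g₂ q,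
    HasAction.trans (t := t) (h₁.congr ?_ ?_) (h₂.congr ?_ ?_), ?_, ?_⟩
  · intro q hq; simp [hq.2]
  · intro q hq; simp [hq.2]
  · intro q hq
    rcases hq.1.eq_or_lt with rfl | hlt
    · simp [ht₁, hs₂]
    · simp [hlt]
  · intro q hq; simp [hq.1]
  · simp [h₁.le, hs₁]
  · rcases h₂.le.eq_or_lt with rfl | hlt
    · simp only [le_refl, if_true]; rw [ht₁, ← ht₂, hs₂]
    · simp [hlt, ht₂]

lemma exists_joins_segment (hL : Continuous (Function.uncurry L)) {R V M : ℝ}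
    (hM : ∀ x v : Eu n, ‖x‖ ≤ R → ‖v‖ ≤ V → L x v ≤ M) (hst : s < t) (hx : ‖x‖ ≤ R) (hy : ‖y‖ ≤ R)
    (hxy : ‖y - x‖ ≤ V * (t - s)) : ∃ A, Joins L s t x y A ∧ A ≤ (t - s) * M := by
  set v : Eu n := (t - s)⁻¹ • (y - x) with hv
  have hts : 0 < t - s := sub_pos.2 hst
  have hvV : ‖v‖ ≤ V := by
    rw [hv, norm_smul, norm_inv, Real.norm_of_nonneg hts.le, inv_mul_le_iff₀ hts]
    linarith
  set f : ℝ → Eu n := fun r => x + (r - s) • v with hf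
  have hcont : Continuous (fun r => L (f r) v) :=
    hL.comp (Continuous.prodMk (by fun_prop) continuous_const)
  have hft : f t = y := by
    simp only [hf, hv]
    rw [smul_inv_smul₀ hts.ne']; abel
  have hfs : f s = x := by simp [hf]
  have hfR : ∀ r ∈ Set.Icc s t, ‖f r‖ ≤ R := by
    intro r hr
    have hc := (convex_closedBall (0 : Eu n) R).add_smul_sub_mem (x := x) (y := y)
      (by simpa using hx) (by simpa using hy) (t := (r - s) / (t - s))
      ⟨div_nonneg (by linarith [hr.1]) hts.le, (div_le_one hts).2 (by linarith [hr.2])⟩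
    have : f r = x + ((r - s) / (t - s)) • (y - x) := by
      simp only [hf, hv, smul_smul, div_eq_mul_inv]
    rw [this]
    simpa using hc
  refine ⟨_, ⟨f, fun _ => v, ⟨hst.le, intervalIntegrable_const, fun r _ => ?_,
    hcont.intervalIntegrable _ _, rfl⟩, hfs, hft⟩, ?_⟩
  · simp [hf]
  · calc ∫ r in s..t, L (f r) v ≤ ∫ r in s..t, M :=
          intervalIntegral.integral_mono_on hst.le (hcont.intervalIntegrable _ _)
            intervalIntegrable_const fun r hr => hM _ _ (hfR r hr) hvV
      _ = (t - s) * M := by simp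

end Curves

section Action

variable {n : ℕ} {L : Eu n → Eu n → ℝ} {a b : ℝ}

lemma pev_of_mem (γ : CPath a b n) {t : ℝ} (ht : t ∈ Set.Icc a b) : pev γ t = γ ⟨t, ht⟩ :=
  dif_pos ht

lemma ae_eq_of_integral_eq (hab : a ≤ b) {g g' : ℝ → Eu n} (hg : IntervalIntegrable g volume a b)
    (hg' : IntervalIntegrable g' volume a b)
    (h : ∀ r ∈ Set.Icc a b, ∫ u in a..r, g u = ∫ u in a..r, g' u) :
    g =ᵐ[volume.restrict (Set.Icc a b)] g' := by
  rw [Filter.EventuallyEq, ae_restrict_iff' measurableSet_Icc]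
  have h₁ : ∀ᵐ x : ℝ, x ≠ a := by simp [ae_iff, measure_singleton]
  have h₂ : ∀ᵐ x : ℝ, x ≠ b := by simp [ae_iff, measure_singleton]
  filter_upwards [hg.ae_hasDerivAt_integral, hg'.ae_hasDerivAt_integral, h₁, h₂]
    with x hx hx' hxa hxb hmem
  rw [Set.uIcc_of_le hab] at hx hx'
  have ha : a ∈ Set.Icc a b := Set.left_mem_Icc.2 hab
  refine (hx hmem a ha).unique ((hx' hmem a ha).congr_of_eventuallyEq ?_)
  filter_upwards [Icc_mem_nhds (lt_of_le_of_ne hmem.1 hxa.symm) (lt_of_le_of_ne hmem.2 hxb)]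
    with r hr using h r hr

lemma HasAction.isACC {γ : CPath a b n} {g : ℝ → Eu n} {A : ℝ}
    (h : HasAction L a b (pev γ) g A) : IsACC γ := by
  refine ⟨g, (intervalIntegrable_iff_integrableOn_Icc_of_le h.le).1 h.integrable, fun s t => ?_⟩
  rw [← h.sub_eq_integral s.2 t.2, pev_of_mem γ s.2, pev_of_mem γ t.2]
  abel

lemma HasAction.action_eq {γ : CPath a b n} {g : ℝ → Eu n} {A : ℝ}
    (h : HasAction L a b (pev γ) g A) : action L a b γ = (A : EReal) := by
  have hacc := h.isACC
  have hab := h.le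
  obtain ⟨hgint, heq⟩ := hacc.choose_spec
  have hae : hacc.choose =ᵐ[volume.restrict (Set.Icc a b)] g := by
    refine ae_eq_of_integral_eq hab ((intervalIntegrable_iff_integrableOn_Icc_of_le hab).2 hgint)
      h.integrable fun r hr => ?_
    rw [← h.sub_eq_integral (Set.left_mem_Icc.2 hab) hr, pev_of_mem γ hr,
      pev_of_mem γ (Set.left_mem_Icc.2 hab), heq ⟨a, Set.left_mem_Icc.2 hab⟩ ⟨r, hr⟩,
      add_sub_cancel_left]
  have haeL : (fun t => L (pev γ t) (hacc.choose t)) =ᵐ[volume.restrict (Set.Icc a b)]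
      fun t => L (pev γ t) (g t) := by
    filter_upwards [hae] with t ht
    rw [ht]
  have hintL : IntegrableOn (fun t => L (pev γ t) (hacc.choose t)) (Set.Icc a b) :=
    ((intervalIntegrable_iff_integrableOn_Icc_of_le hab).1 h.integrable_lagrangian).congr haeL.symm
  rw [action, dif_pos hacc, if_pos hintL, integral_congr_ae haeL, integral_Icc_eq_integral_Ioc,
    ← intervalIntegral.integral_of_le hab, h.integral_lagrangian]

lemma exists_hasAction_of_action_ne_top (hab : a ≤ b) {γ : CPath a b n}
    (h : action L a b γ ≠ ⊤) :
    ∃ g A, HasAction L a b (pev γ) g A ∧ action L a b γ = (A : EReal) := by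
  unfold action at h
  split_ifs at h with hacc hL
  · obtain ⟨hgint, heq⟩ := hacc.choose_spec
    have hA : HasAction L a b (pev γ) hacc.choose
        (∫ t in a..b, L (pev γ t) (hacc.choose t)) := by
      refine ⟨hab, (intervalIntegrable_iff_integrableOn_Icc_of_le hab).2 hgint, fun r hr => ?_,
        (intervalIntegrable_iff_integrableOn_Icc_of_le hab).2 hL, rfl⟩
      rw [pev_of_mem γ hr, pev_of_mem γ (Set.left_mem_Icc.2 hab)]
      exact heq ⟨a, Set.left_mem_Icc.2 hab⟩ ⟨r, hr⟩
    exact ⟨_, _, hA, hA.action_eq⟩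
  all_goals exact absurd rfl h

lemma HasAction.exists_path {f g : ℝ → Eu n} {A : ℝ} (h : HasAction L a b f g A) :
    ∃ γ : CPath a b n, HasAction L a b (pev γ) g A ∧ ∀ t ∈ Set.Icc a b, pev γ t = f t := by
  let γ : CPath a b n := ⟨fun t => f t, h.continuousOn.domRestrict⟩
  have hγ : ∀ t ∈ Set.Icc a b, pev γ t = f t := fun t ht => pev_of_mem γ ht
  exact ⟨γ, h.congr hγ fun _ _ => rfl, hγ⟩

lemma Joins.cost_le {x y : Eu n} {A : ℝ} (h : Joins L a b x y A) : cost L a b x y ≤ (A : EReal) := by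
  obtain ⟨f, g, h, hx, hy⟩ := h
  obtain ⟨γ, hγ, hf⟩ := h.exists_path
  rw [← hγ.action_eq]
  refine iInf₂_le γ ⟨hγ.isACC, ?_, ?_⟩
  · rw [hf a (Set.left_mem_Icc.2 h.le), hx]
  · rw [hf b (Set.right_mem_Icc.2 h.le), hy]

lemma HasAction.le_action {s t : ℝ} {f g : ℝ → Eu n} {A : ℝ} (h : HasAction L s t f g A)
    {c₁ c₂ : ℝ} (hL : ∀ x v : Eu n, c₁ * ‖v‖ - c₂ ≤ L x v) :
    c₁ * (∫ u in s..t, ‖g u‖) - c₂ * (t - s) ≤ A := by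
  have hi : IntervalIntegrable (fun u => c₁ * ‖g u‖ - c₂) volume s t :=
    (h.integrable.norm.const_mul c₁).sub intervalIntegrable_const
  have := intervalIntegral.integral_mono_on h.le hi h.integrable_lagrangian
    fun u _ => hL (f u) (g u)
  rw [h.integral_lagrangian, intervalIntegral.integral_sub (h.integrable.norm.const_mul c₁)
    intervalIntegrable_const, intervalIntegral.integral_const_mul,
    intervalIntegral.integral_const, smul_eq_mul] at this
  linarith

lemma HasAction.neg_le_action {s t : ℝ} {f g : ℝ → Eu n} {A : ℝ} (h : HasAction L s t f g A)
    {c₁ c₂ : ℝ} (hc₁ : 0 ≤ c₁) (hL : ∀ x v : Eu n, c₁ * ‖v‖ - c₂ ≤ L x v) :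
    -(c₂ * (t - s)) ≤ A := by
  have := h.le_action hL
  have h0 : 0 ≤ ∫ u in s..t, ‖g u‖ :=
    intervalIntegral.integral_nonneg h.le fun _ _ => norm_nonneg _
  nlinarith [mul_nonneg hc₁ h0]

lemma HasAction.norm_sub_le {s t : ℝ} {f g : ℝ → Eu n} {A : ℝ} (h : HasAction L s t f g A) {r : ℝ}
    (hr : r ∈ Set.Icc s t) : ‖f r - f s‖ ≤ ∫ u in s..t, ‖g u‖ := by
  rw [h.sub_eq_integral (Set.left_mem_Icc.2 h.le) hr]
  refine (intervalIntegral.norm_integral_le_integral_norm hr.1).trans ?_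
  exact intervalIntegral.integral_mono_interval le_rfl hr.1 hr.2
    (ae_of_all _ fun _ => norm_nonneg _) h.integrable.norm

lemma neg_le_cost (hab : a ≤ b) {c₁ c₂ : ℝ} (hc₁ : 0 ≤ c₁)
    (hL : ∀ x v : Eu n, c₁ * ‖v‖ - c₂ ≤ L x v) (x y : Eu n) :
    ((-(c₂ * (b - a)) : ℝ) : EReal) ≤ cost L a b x y := by
  refine le_iInf₂ fun γ _ => ?_
  by_cases htop : action L a b γ = ⊤
  · rw [htop]; exact le_top
  · obtain ⟨g, A, hA, hEq⟩ := exists_hasAction_of_action_ne_top hab htop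
    rw [hEq]
    exact EReal.coe_le_coe_iff.2 (hA.neg_le_action hc₁ hL)

/-- A Lagrangian that is continuous is bounded above on products of balls. -/
lemma exists_lagrangian_le (hL : Continuous (Function.uncurry L)) (R V : ℝ) :
    ∃ M, ∀ x v : Eu n, ‖x‖ ≤ R → ‖v‖ ≤ V → L x v ≤ M := by
  obtain ⟨M, hM⟩ := ((isCompact_closedBall (0 : Eu n) R).prod
    (isCompact_closedBall (0 : Eu n) V)).bddAbove_image hL.continuousOn
  exact ⟨M, fun x v hx hv => hM ⟨(x, v), ⟨by simpa using hx, by simpa using hv⟩, rfl⟩⟩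

/-- Upper semicontinuity of the cost: endpoints of a finite-action curve can be moved at small
expense, by saving time on a short piece where the mean speed is controlled. -/
lemma HasAction.eventually_cost_le (hab : a < b) (hL : Continuous (Function.uncurry L))
    {c₁ c₂ : ℝ} (hc₁ : 0 ≤ c₁) (hlow : ∀ x v : Eu n, c₁ * ‖v‖ - c₂ ≤ L x v)
    {f g : ℝ → Eu n} {A : ℝ} (h : HasAction L a b f g A) {ε : ℝ} (hε : 0 < ε) :
    ∃ δ > 0, ∀ x y : Eu n, ‖x - f a‖ ≤ δ → ‖y - f b‖ ≤ δ →
      cost L a b x y ≤ ((A + ε : ℝ) : EReal) := by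
  have ha : a ∈ Set.Icc a b := Set.left_mem_Icc.2 hab.le
  have hb : b ∈ Set.Icc a b := Set.right_mem_Icc.2 hab.le
  -- a point of differentiability
  obtain ⟨p, hp, hder⟩ : ∃ p ∈ Set.Ioo a b,
      HasDerivAt (fun x => ∫ u in a..x, g u) (g p) p := by
    have hmeas : (volume.restrict (Set.Ioo a b)) ≠ 0 := by
      simp [Measure.restrict_eq_zero, hab]
    have hae : ∀ᵐ x ∂(volume.restrict (Set.Ioo a b)),
        x ∈ Set.Ioo a b ∧ HasDerivAt (fun x => ∫ u in a..x, g u) (g x) x := by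
      rw [ae_restrict_iff' measurableSet_Ioo]
      filter_upwards [h.integrable.ae_hasDerivAt_integral] with x hx hmem
      rw [Set.uIcc_of_le hab.le] at hx
      exact ⟨hmem, hx (Set.Ioo_subset_Icc_self hmem) a ha⟩
    have : (ae (volume.restrict (Set.Ioo a b))).NeBot := ae_neBot.2 hmeas
    exact hae.exists
  obtain ⟨C, hC⟩ := hder.isBigO_sub.bound
  obtain ⟨η, hη, hball⟩ := Metric.eventually_nhds_iff.1 hC
  obtain ⟨R, hR⟩ := ((isCompact_Icc (a := a) (b := b)).image_of_continuousOn
    h.continuousOn).isBounded.exists_norm_le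
  have hfR : ∀ r ∈ Set.Icc a b, ‖f r‖ ≤ R := fun r hr => hR _ ⟨r, hr, rfl⟩
  set V : ℝ := max 1 (2 * C) with hV
  obtain ⟨M₀, hM₀⟩ := exists_lagrangian_le hL (R + 1) V
  set M : ℝ := max M₀ 0
  have hM : ∀ x v : Eu n, ‖x‖ ≤ R + 1 → ‖v‖ ≤ V → L x v ≤ M := fun x v hx hv =>
    (hM₀ x v hx hv).trans (le_max_left _ _)
  have hM0 : 0 ≤ M := le_max_right _ _
  -- the length of the modified piece
  obtain ⟨d, hd0, hdη, hdb, hd1, hdε⟩ : ∃ d > 0, d < η ∧ p + d ≤ b ∧ d ≤ 1 ∧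
      d * (M + |c₂|) ≤ ε := by
    refine ⟨min (min (η / 2) (b - p)) (min 1 (ε / (M + |c₂| + 1))), ?_, ?_, ?_, ?_, ?_⟩
    · have : 0 < M + |c₂| + 1 := by positivity
      simp only [gt_iff_lt, lt_min_iff]
      exact ⟨⟨by positivity, by linarith [hp.2]⟩, by positivity, by positivity⟩
    · exact ((min_le_left _ _).trans (min_le_left _ _)).trans_lt (by linarith)
    · have : min (min (η / 2) (b - p)) (min 1 (ε / (M + |c₂| + 1))) ≤ b - p :=
        (min_le_left _ _).trans (min_le_right _ _)
      linarith
    · exact (min_le_right _ _).trans (min_le_left _ _)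
    · have h1 : 0 < M + |c₂| + 1 := by positivity
      have h2 : min (min (η / 2) (b - p)) (min 1 (ε / (M + |c₂| + 1))) ≤ ε / (M + |c₂| + 1) :=
        (min_le_right _ _).trans (min_le_right _ _)
      calc _ ≤ ε / (M + |c₂| + 1) * (M + |c₂|) :=
            mul_le_mul_of_nonneg_right h2 (by positivity)
        _ ≤ ε / (M + |c₂| + 1) * (M + |c₂| + 1) :=
            mul_le_mul_of_nonneg_left (by linarith) (by positivity)
        _ = ε := by field_simp
  have hpI : p ∈ Set.Icc a b := Set.Ioo_subset_Icc_self hp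
  have hpdI : p + d ∈ Set.Icc a b := ⟨by linarith [hp.1], hdb⟩
  refine ⟨d / 4, by positivity, fun x y hx hy => ?_⟩
  have hxR : ‖x‖ ≤ R + 1 := by
    have := norm_add_le (x - f a) (f a)
    rw [sub_add_cancel] at this
    linarith [hfR a ha]
  have hyR : ‖y‖ ≤ R + 1 := by
    have := norm_add_le (y - f b) (f b)
    rw [sub_add_cancel] at this
    linarith [hfR b hb]
  have hfR' : ∀ r ∈ Set.Icc a b, ‖f r‖ ≤ R + 1 := fun r hr => (hfR r hr).trans (by linarith)
  have hV1 : 1 ≤ V := le_max_left _ _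
  obtain ⟨A₁, hA₁, hA₁'⟩ := exists_joins_segment hL hM (s := a) (t := a + d / 4) (x := x)
    (y := f a) (by linarith) hxR (hfR' a ha) (by
      rw [norm_sub_rev]; nlinarith)
  have hA₂ := (h.joins ha hpI hp.1.le).shift (d / 4)
  obtain ⟨A₃, hA₃, hA₃'⟩ := exists_joins_segment hL hM (s := p + d / 4) (t := p + d + -(d / 4))
    (x := f p) (y := f (p + d)) (by linarith) (hfR' p hpI) (hfR' _ hpdI) (by
      have h1 := hball (y := p + d) (by simpa [Real.dist_eq, abs_of_pos hd0] using hdη)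
      have h2 := h.sub_eq_integral hpI hpdI
      rw [← h.sub_eq_integral ha hpdI, ← h.sub_eq_integral ha hpI, sub_sub_sub_cancel_right,
        add_sub_cancel_left, Real.norm_of_nonneg hd0.le] at h1
      have h3 : 2 * C ≤ V := le_max_right _ _
      nlinarith)
  have hA₄ := (h.joins hpdI hb hdb).shift (-(d / 4))
  obtain ⟨A₅, hA₅, hA₅'⟩ := exists_joins_segment hL hM (s := b + -(d / 4)) (t := b)
    (x := f b) (y := y) (by linarith) (hfR' b hb) hyR (by nlinarith)
  have hcost := ((((hA₁.trans hA₂).trans hA₃).trans hA₄).trans hA₅).cost_le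
  refine hcost.trans (EReal.coe_le_coe_iff.2 ?_)
  have hmid := (h.restrict hpI hpdI (by linarith)).neg_le_action hc₁ hlow
  have hsplit : (∫ u in a..p, L (f u) (g u)) + (∫ u in p..(p + d), L (f u) (g u)) +
      (∫ u in (p + d)..b, L (f u) (g u)) = A :=
    (((h.restrict ha hpI hp.1.le).trans (h.restrict hpI hpdI (by linarith))).trans
      (h.restrict hpdI hb hdb)).integral_lagrangian.symm.trans h.integral_lagrangian
  have hc := mul_le_mul_of_nonneg_left (le_abs_self c₂) hd0.le
  nlinarith

end Action

section Convexity

variable {n : ℕ} {L : Eu n → Eu n → ℝ}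

/-- The momentum `∇_v L(x, v)`. -/
noncomputable def momentum {n : ℕ} (L : Eu n → Eu n → ℝ) (x v : Eu n) : Eu n :=
  (InnerProductSpace.toDual ℝ (Eu n)).symm (fderiv ℝ (L x) v)

lemma inner_momentum (x v w : Eu n) : inner ℝ (momentum L x v) w = fderiv ℝ (L x) v w := by
  simp [momentum]

lemma contDiff_section (hL : ContDiff ℝ (⊤ : ℕ∞) (Function.uncurry L)) (x : Eu n) :
    ContDiff ℝ (⊤ : ℕ∞) (L x) :=
  hL.comp (f := fun v => (x, v)) (contDiff_const.prodMk contDiff_id)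

lemma continuous_momentum (hL : ContDiff ℝ (⊤ : ℕ∞) (Function.uncurry L)) :
    Continuous (Function.uncurry (momentum L)) := by
  have h : ContDiff ℝ 0 (fun z : Eu n × Eu n => fderiv ℝ (L z.1) z.2) := by
    have h₁ : ContDiff ℝ (⊤ : ℕ∞) fun w : (Eu n × Eu n) × Eu n => (w.1.1, w.2) := by fun_prop
    have h₂ : ContDiff ℝ (⊤ : ℕ∞)
        (Function.uncurry fun (z : Eu n × Eu n) (v : Eu n) => L z.1 v) := hL.comp h₁
    exact h₂.fderiv contDiff_snd (by simp)
  exact (InnerProductSpace.toDual ℝ (Eu n)).symm.continuous.comp h.continuous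

lemma tangent_add_sq_le (hL : ContDiff ℝ (⊤ : ℕ∞) (Function.uncurry L)) {x : Eu n} {c₀ : ℝ}
    (hc : ∀ v w : Eu n, c₀ * ‖w‖ ^ 2 ≤ fderiv ℝ (fderiv ℝ (L x)) v w w) (v w : Eu n) :
    L x v + inner ℝ (momentum L x v) (w - v) + c₀ / 2 * ‖w - v‖ ^ 2 ≤ L x w := by
  have hLx := contDiff_section hL x
  set u := w - v with hu
  have hline : ∀ s : ℝ, HasDerivAt (fun s : ℝ => v + s • u) u s := fun s => by
    simpa using ((hasDerivAt_id s).smul_const u).const_add v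
  have h1 : ∀ s : ℝ, HasDerivAt (fun s : ℝ => L x (v + s • u) - c₀ / 2 * ‖u‖ ^ 2 * s ^ 2)
      (fderiv ℝ (L x) (v + s • u) u - c₀ * ‖u‖ ^ 2 * s) s := fun s => by
    have hd := ((hLx.differentiable (by simp)) (v + s • u)).hasFDerivAt.comp_hasDerivAt s (hline s)
    have hp := ((hasDerivAt_pow 2 s).const_mul (c₀ / 2 * ‖u‖ ^ 2))
    refine (hd.sub hp).congr_deriv ?_
    simp; ring
  have hdiff : Differentiable ℝ (fderiv ℝ (L x)) :=
    (hLx.fderiv_right (m := 1) (by norm_cast)).differentiable one_ne_zero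
  have h2 : ∀ s : ℝ, HasDerivAt (fun s : ℝ => fderiv ℝ (L x) (v + s • u) u - c₀ * ‖u‖ ^ 2 * s)
      (fderiv ℝ (fderiv ℝ (L x)) (v + s • u) u u - c₀ * ‖u‖ ^ 2) s := fun s => by
    have hd := (hdiff (v + s • u)).hasFDerivAt.comp_hasDerivAt s (hline s)
    have hd' := hd.clm_apply (hasDerivAt_const s u)
    have hp := (hasDerivAt_id s).const_mul (c₀ * ‖u‖ ^ 2)
    refine (hd'.sub hp).congr_deriv ?_
    simp
  have hmono : Monotone fun s : ℝ => fderiv ℝ (L x) (v + s • u) u - c₀ * ‖u‖ ^ 2 * s := by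
    refine monotone_of_deriv_nonneg (fun s => (h2 s).differentiableAt) fun s => ?_
    rw [(h2 s).deriv]
    linarith [hc (v + s • u) u]
  obtain ⟨ξ, hξ, heq⟩ := exists_hasDerivAt_eq_slope _ _ (zero_lt_one (α := ℝ))
    (fun s _ => (h1 s).continuousAt.continuousWithinAt) (fun s _ => h1 s)
  have h3 := hmono hξ.1.le
  simp only [zero_smul, add_zero, mul_zero, sub_zero, one_smul, one_pow, mul_one, ne_eq,
    OfNat.ofNat_ne_zero, not_false_eq_true, zero_pow, div_one] at heq h3
  rw [inner_momentum]
  have h4 : v + u = w := by rw [hu]; abel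
  rw [h4] at heq
  linarith

/-- Quadratic growth of the Lagrangian in the velocity, uniformly on balls. -/
lemma exists_quadratic_le (hL1 : ContDiff ℝ (⊤ : ℕ∞) (Function.uncurry L))
    (hL2 : ∀ K : Set (Eu n), IsCompact K → ∃ c₀ : ℝ, 0 < c₀ ∧
      ∀ x ∈ K, ∀ v w : Eu n, c₀ * ‖w‖ ^ 2 ≤ fderiv ℝ (fderiv ℝ (L x)) v w w) (R : ℝ) :
    ∃ κ > 0, ∃ C, ∀ x v : Eu n, ‖x‖ ≤ R → κ * ‖v‖ ^ 2 - C ≤ L x v := by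
  obtain ⟨c₀, hc₀, hc⟩ := hL2 _ (isCompact_closedBall (0 : Eu n) R)
  obtain ⟨Q, hQ⟩ := (isCompact_closedBall (0 : Eu n) R).exists_bound_of_continuousOn
    (f := fun x => momentum L x 0)
    ((continuous_momentum hL1).comp (continuous_id.prodMk continuous_const)).continuousOn
  obtain ⟨m, hm⟩ := (isCompact_closedBall (0 : Eu n) R).exists_bound_of_continuousOn
    (f := fun x => L x 0)
    (hL1.continuous.comp (continuous_id.prodMk continuous_const)).continuousOn
  refine ⟨c₀ / 4, by positivity, m + Q ^ 2 / c₀, fun x v hx => ?_⟩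
  have hx' : x ∈ Metric.closedBall (0 : Eu n) R := by simpa using hx
  have h1 := tangent_add_sq_le hL1 (hc x hx') 0 v
  rw [sub_zero] at h1
  have h2 : -(Q * ‖v‖) ≤ inner ℝ (momentum L x 0) v := by
    have := (abs_real_inner_le_norm (momentum L x 0) v).trans
      (mul_le_mul_of_nonneg_right (hQ x hx') (norm_nonneg v))
    exact (abs_le.1 this).1
  have h3 : -m ≤ L x 0 := (abs_le.1 (hm x hx')).1
  have h4 : Q * ‖v‖ ≤ c₀ / 4 * ‖v‖ ^ 2 + Q ^ 2 / c₀ := by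
    have : c₀ / 4 * ‖v‖ ^ 2 + Q ^ 2 / c₀ - Q * ‖v‖ = (c₀ * ‖v‖ / 2 - Q) ^ 2 / c₀ := by
      field_simp; ring
    have h5 : 0 ≤ (c₀ * ‖v‖ / 2 - Q) ^ 2 / c₀ := by positivity
    linarith
  linarith

end Convexity

section WeakCompactness

variable {ι : Type*}

lemma exists_weak_limit {H : Type*} [NormedAddCommGroup H] [InnerProductSpace ℝ H]
    [CompleteSpace H] (U : Ultrafilter ι) (u : ι → H) {C : ℝ} (hu : ∀ i, ‖u i‖ ≤ C) :
    ∃ w : H, ∀ q : H, Tendsto (fun i => inner ℝ q (u i)) U (𝓝 (inner ℝ q w)) := by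
  let T : ι → WeakDual ℝ H := fun i => StrongDual.toWeakDual (InnerProductSpace.toDual ℝ H (u i))
  have hmem : ∀ i, T i ∈ WeakDual.toStrongDual ⁻¹' Metric.closedBall (0 : StrongDual ℝ H) C := by
    intro i
    simpa [T] using hu i
  obtain ⟨φ, -, hφ⟩ := (WeakDual.isCompact_closedBall (𝕜 := ℝ) (0 : StrongDual ℝ H) C
    ).ultrafilter_le_nhds (U.map T) (by
      rw [Ultrafilter.coe_map, Filter.le_principal_iff]
      exact Filter.mem_map.2 (Filter.univ_mem' hmem))
  refine ⟨(InnerProductSpace.toDual ℝ H).symm (WeakDual.toStrongDual φ), fun q => ?_⟩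
  have h1 : Tendsto (fun i => T i q) U (𝓝 (φ q)) :=
    ((WeakDual.eval_continuous q).tendsto φ).comp hφ
  have h2 : ∀ i, T i q = inner ℝ q (u i) := fun i => by
    simp [T, real_inner_comm q]
  have h3 : φ q = inner ℝ q ((InnerProductSpace.toDual ℝ H).symm (WeakDual.toStrongDual φ)) := by
    rw [real_inner_comm, InnerProductSpace.toDual_symm_apply]; rfl
  rw [← h3]
  exact h1.congr h2

lemma exists_weak_limit_L2 {α E : Type*} [MeasurableSpace α] [NormedAddCommGroup E]
    [InnerProductSpace ℝ E] [CompleteSpace E] {μ : Measure α}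
    (U : Ultrafilter ι) {g : ι → α → E} (hg : ∀ i, MemLp (g i) 2 μ)
    {G : ℝ} (hG : ∀ i, ∫ t, ‖g i t‖ ^ 2 ∂μ ≤ G) :
    ∃ w : α → E, StronglyMeasurable w ∧ MemLp w 2 μ ∧ ∀ q : α → E, MemLp q 2 μ →
      Tendsto (fun i => ∫ t, inner ℝ (q t) (g i t) ∂μ) U (𝓝 (∫ t, inner ℝ (q t) (w t) ∂μ)) := by
  have hinner : ∀ (q f : α → E) (hq : MemLp q 2 μ) (hf : MemLp f 2 μ),
      inner ℝ hq.toLp hf.toLp = ∫ t, inner ℝ (q t) (f t) ∂μ := by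
    intro q f hq hf
    rw [L2.inner_def]
    refine integral_congr_ae ?_
    filter_upwards [hq.coeFn_toLp, hf.coeFn_toLp] with t h1 h2
    rw [h1, h2]
  have hnorm : ∀ i, ‖(hg i).toLp‖ ≤ √G := by
    intro i
    apply Real.le_sqrt_of_sq_le
    rw [← real_inner_self_eq_norm_sq, hinner]
    simpa only [real_inner_self_eq_norm_sq] using hG i
  obtain ⟨w, hw⟩ := exists_weak_limit U (fun i => (hg i).toLp) hnorm
  refine ⟨w, Lp.stronglyMeasurable w, Lp.memLp w, fun q hq => ?_⟩
  have h := hw hq.toLp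
  rw [show w = (Lp.memLp w).toLp from (Lp.toLp_coeFn w _).symm, hinner] at h
  simpa only [hinner] using h

end WeakCompactness

section Convergence

variable {ι : Type*} {n : ℕ} {L : Eu n → Eu n → ℝ} {a b : ℝ}

lemma tendsto_of_forall_inner {l : Filter ι} {y : ι → Eu n} {z : Eu n}
    (h : ∀ c : Eu n, Tendsto (fun i => inner ℝ c (y i)) l (𝓝 (inner ℝ c z))) :
    Tendsto y l (𝓝 z) := by
  have hb := EuclideanSpace.basisFun (Fin n) ℝ
  have h1 := tendsto_finsetSum (s := (Finset.univ : Finset (Fin n)))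
    (f := fun j i => (inner ℝ (hb j) (y i) : ℝ) • hb j) fun j _ => (h (hb j)).smul_const (hb j)
  rw [hb.sum_repr' z] at h1
  exact h1.congr fun i => hb.sum_repr' (y i)

/-- Weak convergence of derivatives tested on intervals. -/
lemma tendsto_intervalIntegral_of_weak {l : Filter ι} {g : ι → ℝ → Eu n}
    {w : ℝ → Eu n} (hg : ∀ i, IntervalIntegrable (g i) volume a b)
    (hw : IntervalIntegrable w volume a b)
    (hweak : ∀ q : ℝ → Eu n, MemLp q 2 (volume.restrict (Set.Ioc a b)) →
      Tendsto (fun i => ∫ t in Set.Ioc a b, inner ℝ (q t) (g i t)) l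
        (𝓝 (∫ t in Set.Ioc a b, inner ℝ (q t) (w t)))) {r : ℝ} (hr : r ∈ Set.Icc a b) :
    Tendsto (fun i => ∫ t in a..r, g i t) l (𝓝 (∫ t in a..r, w t)) := by
  refine tendsto_of_forall_inner fun c => ?_
  have hsub : Set.Ioc a r ⊆ Set.Ioc a b := Set.Ioc_subset_Ioc_right hr.2
  have key : ∀ f : ℝ → Eu n, IntervalIntegrable f volume a b →
      ∫ t in Set.Ioc a b, inner ℝ ((Set.Ioc a r).indicator (fun _ => c) t) (f t) =
        inner ℝ c (∫ t in a..r, f t) := by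
    intro f hf
    have h1 : (fun t => inner ℝ ((Set.Ioc a r).indicator (fun _ => c) t) (f t)) =
        (Set.Ioc a r).indicator fun t => inner ℝ c (f t) := by
      funext t
      by_cases ht : t ∈ Set.Ioc a r <;> simp [ht]
    rw [h1, setIntegral_indicator measurableSet_Ioc, Set.inter_eq_right.2 hsub,
      intervalIntegral.integral_of_le hr.1, integral_inner (hf.1.mono_set hsub)]
  have hmem : MemLp ((Set.Ioc a r).indicator fun _ => c) 2 (volume.restrict (Set.Ioc a b)) :=
    (memLp_const c).indicator measurableSet_Ioc
  have h := hweak _ hmem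
  rw [key w hw] at h
  exact h.congr fun i => key _ (hg i)

lemma integral_norm_le_add {s t : ℝ} (hst : s ≤ t) {g : ℝ → Eu n}
    (hg : IntervalIntegrable g volume s t)
    (hg2 : IntervalIntegrable (fun u => ‖g u‖ ^ 2) volume s t) {η : ℝ} (hη : 0 < η) :
    ∫ u in s..t, ‖g u‖ ≤ η * (∫ u in s..t, ‖g u‖ ^ 2) + (t - s) / (4 * η) := by
  have hpt : ∀ u, ‖g u‖ ≤ η * ‖g u‖ ^ 2 + 1 / (4 * η) := by
    intro u
    have : η * ‖g u‖ ^ 2 + 1 / (4 * η) - ‖g u‖ = (2 * η * ‖g u‖ - 1) ^ 2 / (4 * η) := by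
      field_simp; ring
    have h2 : 0 ≤ (2 * η * ‖g u‖ - 1) ^ 2 / (4 * η) := by positivity
    linarith
  have := intervalIntegral.integral_mono_on hst hg.norm
    ((hg2.const_mul η).add intervalIntegrable_const) fun u _ => hpt u
  rw [intervalIntegral.integral_add (hg2.const_mul η) intervalIntegrable_const,
    intervalIntegral.integral_const_mul, intervalIntegral.integral_const, smul_eq_mul] at this
  rwa [div_eq_mul_one_div (t - s)]

/-- Paths with derivatives bounded in `L²` form an equicontinuous family. -/
lemma equicontinuous_of_integral_sq_le {γ : ι → CPath a b n} {g : ι → ℝ → Eu n} {A : ι → ℝ}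
    (h : ∀ i, HasAction L a b (pev (γ i)) (g i) (A i))
    (hg2 : ∀ i, IntervalIntegrable (fun u => ‖g i u‖ ^ 2) volume a b) {G : ℝ}
    (hG : ∀ i, ∫ u in a..b, ‖g i u‖ ^ 2 ≤ G) :
    Equicontinuous fun i => (γ i : Set.Icc a b → Eu n) := by
  have key : ∀ i, ∀ η > 0, ∀ s t : Set.Icc a b, (s : ℝ) ≤ t →
      dist (γ i s) (γ i t) ≤ η * G + (t - s) / (4 * η) := by
    intro i η hη s t hst
    have hsub : Set.uIcc (s : ℝ) t ⊆ Set.uIcc a b := by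
      rw [Set.uIcc_of_le (h i).le, Set.uIcc_of_le hst]; exact Set.Icc_subset_Icc s.2.1 t.2.2
    have h1 := (h i).sub_eq_integral s.2 t.2
    rw [pev_of_mem _ s.2, pev_of_mem _ t.2] at h1
    rw [dist_comm, dist_eq_norm]
    change ‖γ i ⟨t, t.2⟩ - γ i ⟨s, s.2⟩‖ ≤ _
    rw [h1]
    refine (intervalIntegral.norm_integral_le_integral_norm hst).trans
      ((integral_norm_le_add hst ((h i).integrable.mono_set hsub)
        ((hg2 i).mono_set hsub) hη).trans ?_)
    have h2 : ∫ u in (s : ℝ)..t, ‖g i u‖ ^ 2 ≤ ∫ u in a..b, ‖g i u‖ ^ 2 :=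
      intervalIntegral.integral_mono_interval s.2.1 hst t.2.2
        (ae_of_all _ fun _ => by positivity) (hg2 i)
    have h3 := mul_le_mul_of_nonneg_left (h2.trans (hG i)) hη.le
    linarith
  intro t₀
  rw [Metric.equicontinuousAt_iff]
  intro ε hε
  obtain ⟨η, hη, hηG⟩ : ∃ η > 0, η * G ≤ ε / 2 := by
    refine ⟨ε / 2 / (|G| + 1), by positivity, ?_⟩
    have h1 := mul_le_mul_of_nonneg_left (le_abs_self G)
      (show 0 ≤ ε / 2 / (|G| + 1) by positivity)
    have h2 : ε / 2 / (|G| + 1) * (|G| + 1) = ε / 2 := by field_simp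
    nlinarith [show 0 < ε / 2 / (|G| + 1) by positivity]
  refine ⟨ε * η, by positivity, fun t ht i => ?_⟩
  have hd : |(t : ℝ) - t₀| < ε * η := by simpa [Subtype.dist_eq, Real.dist_eq] using ht
  have hlt : |(t : ℝ) - t₀| / (4 * η) < ε / 4 := by
    rw [div_lt_iff₀ (by positivity)]; nlinarith
  rcases le_total (t : ℝ) t₀ with hle | hle
  · have h1 := key i η hη t t₀ hle
    rw [dist_comm (γ i t₀)]
    rw [abs_of_nonpos (by linarith), neg_sub] at hlt
    linarith
  · have h1 := key i η hη t₀ t hle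
    rw [abs_of_nonneg (by linarith)] at hlt
    linarith

lemma tendsto_path_of_equicontinuous {l : Filter ι} {γ : ι → CPath a b n} {γ₀ : CPath a b n}
    (hequi : Equicontinuous fun i => (γ i : Set.Icc a b → Eu n))
    (h : ∀ t, Tendsto (fun i => γ i t) l (𝓝 (γ₀ t))) : Tendsto γ l (𝓝 γ₀) := by
  rw [ContinuousMap.tendsto_iff_tendstoUniformly]
  exact UniformFun.tendsto_iff_tendstoUniformly.1
    ((hequi.tendsto_uniformFun_iff_pi l γ₀).2 (tendsto_pi_nhds.2 h))

end Convergence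

section LowerSemicontinuity

variable {ι : Type*} {n : ℕ} {L : Eu n → Eu n → ℝ} {a b : ℝ}

lemma exists_dist_lt_of_continuous {X : Type*} [PseudoMetricSpace X] {F : Eu n → Eu n → X}
    (hF : Continuous (Function.uncurry F)) (R M : ℝ) {ε : ℝ} (hε : 0 < ε) :
    ∃ δ > 0, ∀ x y v : Eu n, ‖x‖ ≤ R → ‖y‖ ≤ R → ‖v‖ ≤ M → dist x y < δ →
      dist (F x v) (F y v) ≤ ε := by
  have huc := ((isCompact_closedBall (0 : Eu n) R).prod
    (isCompact_closedBall (0 : Eu n) M)).uniformContinuousOn_of_continuous hF.continuousOn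
  obtain ⟨δ, hδ, h⟩ := Metric.uniformContinuousOn_iff.1 huc ε hε
  refine ⟨δ, hδ, fun x y v hx hy hv hxy => ?_⟩
  exact (h (x, v) ⟨by simpa using hx, by simpa using hv⟩ (y, v)
    ⟨by simpa using hy, by simpa using hv⟩ (by simpa [Prod.dist_eq, hδ] using hxy)).le

lemma exists_bound_of_continuous {X : Type*} [SeminormedAddCommGroup X] {F : Eu n → Eu n → X}
    (hF : Continuous (Function.uncurry F)) (R M : ℝ) :
    ∃ C, ∀ x v : Eu n, ‖x‖ ≤ R → ‖v‖ ≤ M → ‖F x v‖ ≤ C := by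
  obtain ⟨C, hC⟩ := ((isCompact_closedBall (0 : Eu n) R).prod
    (isCompact_closedBall (0 : Eu n) M)).exists_bound_of_continuousOn hF.continuousOn
  exact ⟨C, fun x v hx hv => hC (x, v) ⟨by simpa using hx, by simpa using hv⟩⟩

/-- Tangent-plane lower bound for the limit action, with the velocity replaced by a bounded
measurable field `p`. -/
lemma integral_tangent_le {U : Filter ι} [U.NeBot]
    (hL1 : ContDiff ℝ (⊤ : ℕ∞) (Function.uncurry L))
    (hL2 : ∀ K : Set (Eu n), IsCompact K → ∃ c₀ : ℝ, 0 < c₀ ∧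
      ∀ x ∈ K, ∀ v w : Eu n, c₀ * ‖w‖ ^ 2 ≤ fderiv ℝ (fderiv ℝ (L x)) v w w)
    {γ : ι → CPath a b n} {γ₀ : CPath a b n} {g : ι → ℝ → Eu n} {A : ι → ℝ} {w : ℝ → Eu n}
    (h : ∀ i, HasAction L a b (pev (γ i)) (g i) (A i)) {R : ℝ}
    (hR : ∀ i, ∀ t ∈ Set.Icc a b, ‖pev (γ i) t‖ ≤ R) {D : ℝ}
    (hD : ∀ i, ∫ t in a..b, ‖g i t‖ ≤ D)
    (hγ : Tendsto γ U (𝓝 γ₀)) (hγ₀ : ContinuousOn (pev γ₀) (Set.Icc a b))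
    (hw : MemLp w 2 (volume.restrict (Set.Ioc a b)))
    (hweak : ∀ q : ℝ → Eu n, MemLp q 2 (volume.restrict (Set.Ioc a b)) →
      Tendsto (fun i => ∫ t in Set.Ioc a b, inner ℝ (q t) (g i t)) U
        (𝓝 (∫ t in Set.Ioc a b, inner ℝ (q t) (w t))))
    {β : ℝ} (hβ : ∀ᶠ i in U, A i ≤ β) {p : ℝ → Eu n} (hp : StronglyMeasurable p) {M : ℝ}
    (hpM : ∀ t, ‖p t‖ ≤ M) :
    IntegrableOn (fun t => L (pev γ₀ t) (p t) +
        inner ℝ (momentum L (pev γ₀ t) (p t)) (w t - p t)) (Set.Ioc a b) ∧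
      ∫ t in Set.Ioc a b, (L (pev γ₀ t) (p t) +
        inner ℝ (momentum L (pev γ₀ t) (p t)) (w t - p t)) ≤ β := by
  set μ := volume.restrict (Set.Ioc a b) with hμ
  obtain ⟨i₀⟩ : Nonempty ι := U.nonempty_of_neBot
  have hab := (h i₀).le
  have hM0 : 0 ≤ M := (norm_nonneg _).trans (hpM 0)
  have hγ₀R : ∀ t ∈ Set.Icc a b, ‖pev γ₀ t‖ ≤ R := by
    intro t ht
    have : Tendsto (fun i => ‖pev (γ i) t‖) U (𝓝 ‖pev γ₀ t‖) := by
      simp only [pev_of_mem _ ht]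
      exact (((continuous_eval_const (⟨t, ht⟩ : Set.Icc a b)).tendsto γ₀).comp
        hγ).norm
    exact le_of_tendsto this (Eventually.of_forall fun i => hR i t ht)
  have hmeasγ : AEStronglyMeasurable (pev γ₀) μ :=
    (hγ₀.mono Set.Ioc_subset_Icc_self).aestronglyMeasurable measurableSet_Ioc
  have hpmeas : AEStronglyMeasurable p μ := hp.aestronglyMeasurable
  have hmom := continuous_momentum hL1
  set q : ℝ → Eu n := fun t => momentum L (pev γ₀ t) (p t) with hq
  set l : ℝ → ℝ := fun t => L (pev γ₀ t) (p t) with hl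
  obtain ⟨Cq, hCq⟩ := exists_bound_of_continuous hmom R M
  obtain ⟨Cl, hCl⟩ := exists_bound_of_continuous hL1.continuous R M
  have hqmeas : AEStronglyMeasurable q μ :=
    hmom.comp_aestronglyMeasurable (hmeasγ.prodMk hpmeas)
  have hlmeas : AEStronglyMeasurable l μ :=
    hL1.continuous.comp_aestronglyMeasurable (hmeasγ.prodMk hpmeas)
  have hqLp : MemLp q 2 μ := by
    refine MemLp.of_bound hqmeas Cq ?_
    rw [hμ, ae_restrict_iff' measurableSet_Ioc]
    exact ae_of_all _ fun t ht => hCq _ _ (hγ₀R t (Set.Ioc_subset_Icc_self ht)) (hpM t)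
  have hlint : Integrable l μ := by
    refine Integrable.of_bound hlmeas Cl ?_
    rw [hμ, ae_restrict_iff' measurableSet_Ioc]
    exact ae_of_all _ fun t ht => hCl _ _ (hγ₀R t (Set.Ioc_subset_Icc_self ht)) (hpM t)
  have hqf : ∀ f : ℝ → Eu n, Integrable f μ → Integrable (fun t => inner ℝ (q t) (f t)) μ := by
    intro f hf
    refine (hf.norm.const_mul Cq).mono' (hqmeas.inner hf.aestronglyMeasurable) ?_
    rw [hμ, ae_restrict_iff' measurableSet_Ioc]
    refine ae_of_all _ fun t ht => (norm_inner_le_norm _ _).trans ?_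
    exact mul_le_mul_of_nonneg_right
      (hCq _ _ (hγ₀R t (Set.Ioc_subset_Icc_self ht)) (hpM t)) (norm_nonneg _)
  have hqw := hqf w (hw.integrable one_le_two)
  have hlqp : Integrable (fun t => l t - inner ℝ (q t) (p t)) μ :=
    hlint.sub (hqf p (Integrable.of_bound hpmeas M (ae_of_all _ hpM)))
  have hqg : ∀ i, Integrable (fun t => inner ℝ (q t) (g i t)) μ :=
    fun i => hqf _ (h i).integrable.1
  have hfun : (fun t => l t + inner ℝ (q t) (w t - p t)) =
      fun t => (l t - inner ℝ (q t) (p t)) + inner ℝ (q t) (w t) := by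
    funext t; rw [inner_sub_right]; ring
  have hmain : ∫ t, (l t + inner ℝ (q t) (w t - p t)) ∂μ =
      ∫ t, (l t - inner ℝ (q t) (p t)) ∂μ + ∫ t, inner ℝ (q t) (w t) ∂μ := by
    rw [hfun, integral_add hlqp hqw]
  refine ⟨by rw [IntegrableOn, hfun]; exact hlqp.add hqw, ?_⟩
  rw [hmain]
  obtain ⟨c₀, hc₀, hc⟩ := hL2 _ (isCompact_closedBall (0 : Eu n) R)
  have hstep : ∀ ε > 0, ∫ t, (l t - inner ℝ (q t) (p t)) ∂μ + ∫ t, inner ℝ (q t) (w t) ∂μ ≤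
      β + ε * ((1 + M) * (b - a) + D) := by
    intro ε hε
    obtain ⟨δ₁, hδ₁, h₁⟩ := exists_dist_lt_of_continuous hL1.continuous R M hε
    obtain ⟨δ₂, hδ₂, h₂⟩ := exists_dist_lt_of_continuous hmom R M hε
    refine le_of_tendsto ((hweak q hqLp).const_add _) ?_
    filter_upwards [hβ, hγ (Metric.ball_mem_nhds γ₀ (lt_min hδ₁ hδ₂))] with i hi hball
    have hball : dist (γ i) γ₀ < min δ₁ δ₂ := hball
    have hpt : ∀ t ∈ Set.Ioc a b, (l t - inner ℝ (q t) (p t)) + inner ℝ (q t) (g i t) -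
        ε * ((1 + M) + ‖g i t‖) ≤ L (pev (γ i) t) (g i t) := by
      intro t ht'
      have ht := Set.Ioc_subset_Icc_self ht'
      have hdist : dist (pev (γ i) t) (pev γ₀ t) < min δ₁ δ₂ := by
        rw [pev_of_mem _ ht, pev_of_mem _ ht]
        exact (ContinuousMap.dist_apply_le_dist _).trans_lt hball
      have e₁ := h₁ _ _ (p t) (hR i t ht) (hγ₀R t ht) (hpM t) (hdist.trans_le (min_le_left _ _))
      have e₂ := h₂ _ _ (p t) (hR i t ht) (hγ₀R t ht) (hpM t) (hdist.trans_le (min_le_right _ _))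
      have e₃ := tangent_add_sq_le hL1 (hc (pev (γ i) t) (by simpa using hR i t ht)) (p t) (g i t)
      have e₄ : 0 ≤ c₀ / 2 * ‖g i t - p t‖ ^ 2 := by positivity
      have e₅ : |inner ℝ (momentum L (pev (γ i) t) (p t) - q t) (g i t - p t)| ≤
          ε * (‖g i t‖ + M) := by
        refine (abs_real_inner_le_norm _ _).trans ?_
        rw [← dist_eq_norm]
        exact mul_le_mul e₂ ((norm_sub_le _ _).trans (by linarith [hpM t])) (norm_nonneg _) hε.le
      rw [inner_sub_left, inner_sub_right (q t)] at e₅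
      rw [Real.dist_eq] at e₁
      have e₆ := (abs_le.1 e₁).1
      have e₇ := (abs_le.1 e₅).1
      change -ε ≤ L (pev (γ i) t) (p t) - l t at e₆
      linarith
    have hgn : Integrable (fun t => ‖g i t‖) μ := (h i).integrable.1.norm
    have hintl : Integrable (fun t => (l t - inner ℝ (q t) (p t)) + inner ℝ (q t) (g i t)) μ :=
      hlqp.add (hqg i)
    have hintr : Integrable (fun t => ε * ((1 + M) + ‖g i t‖)) μ :=
      ((integrable_const _).add hgn).const_mul ε
    have hle := setIntegral_mono_on (hintl.sub hintr) (h i).integrable_lagrangian.1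
      measurableSet_Ioc hpt
    rw [← intervalIntegral.integral_of_le (f := fun t => L (pev (γ i) t) (g i t)) hab,
      (h i).integral_lagrangian] at hle
    change ∫ t, ((l t - inner ℝ (q t) (p t)) + inner ℝ (q t) (g i t) -
        ε * ((1 + M) + ‖g i t‖)) ∂μ ≤ A i at hle
    rw [integral_sub hintl hintr, integral_add hlqp (hqg i), integral_const_mul,
      integral_add (integrable_const _) hgn, integral_const] at hle
    have hDi := hD i
    rw [intervalIntegral.integral_of_le hab] at hDi
    have hvol : μ.real Set.univ = b - a := by
      simp [hμ, measureReal_def, hab]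
    rw [hvol, smul_eq_mul] at hle
    have := mul_le_mul_of_nonneg_left hDi hε.le
    change ε * (∫ t, ‖g i t‖ ∂μ) ≤ _ at this
    linarith
  have hlim : Tendsto (fun ε : ℝ => β + ε * ((1 + M) * (b - a) + D)) (𝓝[>] 0) (𝓝 β) := by
    have : Tendsto (fun ε : ℝ => β + ε * ((1 + M) * (b - a) + D)) (𝓝 0)
        (𝓝 (β + 0 * ((1 + M) * (b - a) + D))) :=
      (Continuous.tendsto (by fun_prop) 0)
    rw [zero_mul, add_zero] at this
    exact this.mono_left nhdsWithin_le_nhds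
  exact ge_of_tendsto hlim (by filter_upwards [self_mem_nhdsWithin] with ε hε using hstep ε hε)

end LowerSemicontinuity

section Limit

variable {ι : Type*} {n : ℕ} {L : Eu n → Eu n → ℝ} {a b : ℝ}

/-- Lower semicontinuity of the action under uniform convergence of curves and weak `L²`
convergence of velocities. -/
lemma integral_lagrangian_le_of_tendsto {U : Filter ι} [U.NeBot]
    (hL1 : ContDiff ℝ (⊤ : ℕ∞) (Function.uncurry L))
    (hL2 : ∀ K : Set (Eu n), IsCompact K → ∃ c₀ : ℝ, 0 < c₀ ∧
      ∀ x ∈ K, ∀ v w : Eu n, c₀ * ‖w‖ ^ 2 ≤ fderiv ℝ (fderiv ℝ (L x)) v w w)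
    {γ : ι → CPath a b n} {γ₀ : CPath a b n} {g : ι → ℝ → Eu n} {A : ι → ℝ} {w : ℝ → Eu n}
    (h : ∀ i, HasAction L a b (pev (γ i)) (g i) (A i)) {R : ℝ}
    (hR : ∀ i, ∀ t ∈ Set.Icc a b, ‖pev (γ i) t‖ ≤ R) {D : ℝ}
    (hD : ∀ i, ∫ t in a..b, ‖g i t‖ ≤ D)
    (hγ : Tendsto γ U (𝓝 γ₀)) (hγ₀ : ContinuousOn (pev γ₀) (Set.Icc a b))
    (hw : MemLp w 2 (volume.restrict (Set.Ioc a b))) (hwm : StronglyMeasurable w)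
    (hweak : ∀ q : ℝ → Eu n, MemLp q 2 (volume.restrict (Set.Ioc a b)) →
      Tendsto (fun i => ∫ t in Set.Ioc a b, inner ℝ (q t) (g i t)) U
        (𝓝 (∫ t in Set.Ioc a b, inner ℝ (q t) (w t))))
    {β : ℝ} (hβ : ∀ᶠ i in U, A i ≤ β) :
    IntegrableOn (fun t => L (pev γ₀ t) (w t)) (Set.Ioc a b) ∧
      ∫ t in Set.Ioc a b, L (pev γ₀ t) (w t) ≤ β := by
  set μ := volume.restrict (Set.Ioc a b) with hμ
  let E : ℕ → Set ℝ := fun M => {t | ‖w t‖ ≤ M}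
  have hE : ∀ M, MeasurableSet (E M) := fun M =>
    hwm.norm.measurable measurableSet_Iic
  have hcover : AECover μ atTop E := by
    refine ⟨ae_of_all _ fun t => ?_, hE⟩
    obtain ⟨N, hN⟩ := exists_nat_ge ‖w t‖
    filter_upwards [eventually_ge_atTop N] with M hM
    exact hN.trans (Nat.cast_le.2 hM)
  set ℓ : ℝ → ℝ := fun t => L (pev γ₀ t) 0 + inner ℝ (momentum L (pev γ₀ t) 0) (w t) with hℓ
  set Ψ : ℝ → ℝ := fun t => L (pev γ₀ t) (w t) - ℓ t with hΨ
  have hℓint : Integrable ℓ μ := by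
    have := (integral_tangent_le hL1 hL2 h hR hD hγ hγ₀ hw hweak hβ
      (p := fun _ => 0) stronglyMeasurable_const (M := 0) (by simp)).1
    simp only [sub_zero] at this
    exact this
  have hΨ0 : ∀ t, 0 ≤ Ψ t := by
    intro t
    obtain ⟨c₀, hc₀, hc⟩ := hL2 {pev γ₀ t} isCompact_singleton
    have h1 := tangent_add_sq_le hL1 (hc _ rfl) 0 (w t)
    rw [sub_zero] at h1
    have h2 : 0 ≤ c₀ / 2 * ‖w t‖ ^ 2 := by positivity
    simp only [hΨ, hℓ]
    linarith
  have hkey : ∀ M, IntegrableOn Ψ (E M) μ ∧ ∫ t in E M, Ψ t ∂μ ≤ β - ∫ t, ℓ t ∂μ := by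
    intro M
    obtain ⟨h1, h2⟩ := integral_tangent_le hL1 hL2 h hR hD hγ hγ₀ hw hweak hβ
      (p := (E M).indicator w) (hwm.indicator (hE M)) (M := M) (fun t => by
        by_cases ht : t ∈ E M
        · rw [Set.indicator_of_mem ht]; exact ht
        · rw [Set.indicator_of_notMem ht]; simp)
    have heq : (fun t => L (pev γ₀ t) ((E M).indicator w t) +
        inner ℝ (momentum L (pev γ₀ t) ((E M).indicator w t)) (w t - (E M).indicator w t)) =
        fun t => ℓ t + (E M).indicator Ψ t := by
      funext t
      by_cases ht : t ∈ E M
      · simp [ht, hΨ]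
      · simp [ht, hℓ]
    rw [heq] at h1 h2
    have h3 : Integrable ((E M).indicator Ψ) μ := by
      refine (Integrable.sub h1 hℓint).congr (ae_of_all _ fun t => ?_)
      simp
    refine ⟨(integrable_indicator_iff (hE M)).1 h3, ?_⟩
    rw [integral_add hℓint h3, integral_indicator (hE M)] at h2
    linarith
  have hΨint : Integrable Ψ μ :=
    hcover.integrable_of_integral_bounded_of_nonneg_ae _ (fun M => (hkey M).1)
      (ae_of_all _ hΨ0) (Eventually.of_forall fun M => (hkey M).2)
  have hΨle : ∫ t, Ψ t ∂μ ≤ β - ∫ t, ℓ t ∂μ :=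
    le_of_tendsto (hcover.integral_tendsto_of_countably_generated hΨint)
      (Eventually.of_forall fun M => (hkey M).2)
  have hsum : (fun t => L (pev γ₀ t) (w t)) = fun t => ℓ t + Ψ t := by
    funext t; simp [hΨ]
  rw [IntegrableOn, hsum]
  refine ⟨hℓint.add hΨint, ?_⟩
  rw [integral_add hℓint hΨint]
  linarith

/-- Compactness of sublevel sets of the action, together with its lower semicontinuity. -/
lemma exists_tendsto_of_action_le (hL1 : ContDiff ℝ (⊤ : ℕ∞) (Function.uncurry L))
    (hL2 : ∀ K : Set (Eu n), IsCompact K → ∃ c₀ : ℝ, 0 < c₀ ∧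
      ∀ x ∈ K, ∀ v w : Eu n, c₀ * ‖w‖ ^ 2 ≤ fderiv ℝ (fderiv ℝ (L x)) v w w)
    {c₁ c₂ : ℝ} (hc₁ : 0 < c₁) (hL3 : ∀ x v : Eu n, c₁ * ‖v‖ - c₂ ≤ L x v)
    (U : Ultrafilter ι) {γ : ι → CPath a b n} {g : ι → ℝ → Eu n} {A : ι → ℝ}
    (h : ∀ i, HasAction L a b (pev (γ i)) (g i) (A i)) {R B : ℝ}
    (hR : ∀ i, ‖pev (γ i) a‖ ≤ R) (hB : ∀ i, A i ≤ B) :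
    ∃ γ₀ w A₀, Tendsto γ U (𝓝 γ₀) ∧ HasAction L a b (pev γ₀) w A₀ ∧
      ∀ β, (∀ᶠ i in U, A i ≤ β) → A₀ ≤ β := by
  obtain ⟨i₀⟩ : Nonempty ι := (U : Filter ι).nonempty_of_neBot
  have hab := (h i₀).le
  have ha : a ∈ Set.Icc a b := Set.left_mem_Icc.2 hab
  set D := (B + c₂ * (b - a)) / c₁ with hDdef
  have hD : ∀ i, ∫ t in a..b, ‖g i t‖ ≤ D := by
    intro i
    rw [hDdef, le_div_iff₀ hc₁]
    linarith [(h i).le_action hL3, hB i]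
  have hRD : ∀ i, ∀ t ∈ Set.Icc a b, ‖pev (γ i) t‖ ≤ R + D := by
    intro i t ht
    have h1 := (h i).norm_sub_le ht
    have h2 := norm_le_norm_add_norm_sub' (pev (γ i) t) (pev (γ i) a)
    linarith [hR i, hD i]
  obtain ⟨κ, hκ, C, hC⟩ := exists_quadratic_le hL1 hL2 (R + D)
  have hsq : ∀ i, IntervalIntegrable (fun u => ‖g i u‖ ^ 2) volume a b := by
    intro i
    rw [intervalIntegrable_iff_integrableOn_Ioc_of_le hab]
    have hbd : Integrable (fun t => κ⁻¹ * (L (pev (γ i) t) (g i t) + C))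
        (volume.restrict (Set.Ioc a b)) :=
      ((h i).integrable_lagrangian.1.add (integrable_const C)).const_mul κ⁻¹
    refine hbd.mono' ((h i).integrable.1.aestronglyMeasurable.norm.pow 2) ?_
    rw [ae_restrict_iff' measurableSet_Ioc]
    refine ae_of_all _ fun t ht => ?_
    have h1 := hC _ (g i t) (hRD i t (Set.Ioc_subset_Icc_self ht))
    rw [Real.norm_of_nonneg (by positivity), le_inv_mul_iff₀ hκ]
    linarith
  have hG : ∀ i, ∫ u in a..b, ‖g i u‖ ^ 2 ≤ κ⁻¹ * (B + C * (b - a)) := by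
    intro i
    have h1 := intervalIntegral.integral_mono_on hab
      (((hsq i).const_mul κ).sub intervalIntegrable_const) (h i).integrable_lagrangian
      fun t ht => hC _ (g i t) (hRD i t ht)
    rw [(h i).integral_lagrangian, intervalIntegral.integral_sub ((hsq i).const_mul κ)
      intervalIntegrable_const, intervalIntegral.integral_const_mul,
      intervalIntegral.integral_const, smul_eq_mul] at h1
    rw [le_inv_mul_iff₀ hκ]
    linarith [hB i]
  have hmem : ∀ i, MemLp (g i) 2 (volume.restrict (Set.Ioc a b)) := fun i =>
    (memLp_two_iff_integrable_sq_norm (h i).integrable.1.aestronglyMeasurable).2 (hsq i).1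
  obtain ⟨w, hwm, hw, hweak⟩ := exists_weak_limit_L2 U hmem
    (G := κ⁻¹ * (B + C * (b - a))) fun i => by
      simpa only [intervalIntegral.integral_of_le hab] using hG i
  have hwint : IntervalIntegrable w volume a b :=
    (intervalIntegrable_iff_integrableOn_Ioc_of_le hab).2 (hw.integrable one_le_two)
  obtain ⟨x, -, hx⟩ := (isCompact_closedBall (0 : Eu n) R).ultrafilter_le_nhds
    (U.map fun i => pev (γ i) a) (by
      rw [Ultrafilter.coe_map, Filter.le_principal_iff]
      exact Filter.mem_map.2 (Filter.univ_mem' fun i => by simpa using hR i))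
  have hcont : ContinuousOn (fun t => x + ∫ u in a..t, w u) (Set.Icc a b) := by
    have := intervalIntegral.continuousOn_primitive_interval (μ := volume) (f := w) (a := a) (b := b)
      (by rwa [Set.uIcc_of_le hab, ← intervalIntegrable_iff_integrableOn_Icc_of_le hab])
    rw [Set.uIcc_of_le hab] at this
    exact continuousOn_const.add this
  let γ₀ : CPath a b n := ⟨fun t => x + ∫ u in a..(t : ℝ), w u, hcont.domRestrict⟩
  have hγ₀ : ∀ t ∈ Set.Icc a b, pev γ₀ t = x + ∫ u in a..t, w u := fun t ht => pev_of_mem γ₀ ht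
  have htend : Tendsto γ U (𝓝 γ₀) := by
    refine tendsto_path_of_equicontinuous (equicontinuous_of_integral_sq_le h hsq hG) fun t => ?_
    have h1 : Tendsto (fun i => pev (γ i) a + ∫ u in a..(t : ℝ), g i u) U (𝓝 (γ₀ t)) :=
      Tendsto.add hx (tendsto_intervalIntegral_of_weak (fun i => (h i).integrable) hwint hweak t.2)
    refine h1.congr fun i => ?_
    rw [← (h i).eq_add_integral t t.2, pev_of_mem _ t.2]
  have hγ₀c : ContinuousOn (pev γ₀) (Set.Icc a b) := hcont.congr hγ₀
  have hlsc : ∀ β, (∀ᶠ i in U, A i ≤ β) → _ := fun β hβ =>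
    integral_lagrangian_le_of_tendsto hL1 hL2 h hRD hD htend hγ₀c hw hwm hweak hβ
  refine ⟨γ₀, w, _, htend, ⟨hab, hwint, fun r hr => ?_, ?_, rfl⟩, fun β hβ => ?_⟩
  · rw [hγ₀ r hr, hγ₀ a ha, intervalIntegral.integral_same, add_zero]
  · rw [intervalIntegrable_iff_integrableOn_Ioc_of_le hab]
    exact (hlsc B (Eventually.of_forall hB)).1
  · rw [intervalIntegral.integral_of_le hab]
    exact (hlsc β hβ).2

end Limit

section Minimality

variable {n : ℕ} {L : Eu n → Eu n → ℝ} {a b : ℝ}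

lemma exists_cost_le (hab : a < b) (hL : Continuous (Function.uncurry L)) (R : ℝ) :
    ∃ B : ℝ, ∀ x y : Eu n, ‖x‖ ≤ R → ‖y‖ ≤ R → cost L a b x y ≤ (B : EReal) := by
  obtain ⟨M, hM⟩ := exists_lagrangian_le hL R (2 * R / (b - a))
  refine ⟨(b - a) * M, fun x y hx hy => ?_⟩
  obtain ⟨A, hA, hAM⟩ := exists_joins_segment hL hM hab hx hy (by
    rw [div_mul_cancel₀ _ (sub_pos.2 hab).ne']
    linarith [norm_sub_le y x])
  exact hA.cost_le.trans (EReal.coe_le_coe_iff.2 hAM)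

lemma cost_le_action {γ : CPath a b n} : cost L a b (pev γ a) (pev γ b) ≤ action L a b γ := by
  by_cases h : IsACC γ
  · exact iInf₂_le γ ⟨h, rfl, rfl⟩
  · rw [action, dif_neg h]; exact le_top

lemma action_eq_cost {K₁ K₂ : Set (Eu n)} {γ : CPath a b n} (h : γ ∈ GammaMin L a b K₁ K₂) :
    action L a b γ = cost L a b (pev γ a) (pev γ b) :=
  le_antisymm (le_iInf₂ fun γ' hγ' => h.2.2.2 γ' hγ'.1 hγ'.2.1 hγ'.2.2) cost_le_action

/-- Almost minimizing curves are close to minimizing ones. -/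
lemma exists_infDist_lt_of_action_lt (hab : a < b)
    (hL1 : ContDiff ℝ (⊤ : ℕ∞) (Function.uncurry L))
    (hL2 : ∀ K : Set (Eu n), IsCompact K → ∃ c₀ : ℝ, 0 < c₀ ∧
      ∀ x ∈ K, ∀ v w : Eu n, c₀ * ‖w‖ ^ 2 ≤ fderiv ℝ (fderiv ℝ (L x)) v w w)
    {c₁ c₂ : ℝ} (hc₁ : 0 < c₁) (hL3 : ∀ x v : Eu n, c₁ * ‖v‖ - c₂ ≤ L x v)
    {K₁ K₂ : Set (Eu n)} (hK₁ : IsCompact K₁) (hK₂ : IsCompact K₂) {s : ℝ} (hs : 0 < s) :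
    ∃ ε : ℝ, 0 < ε ∧ ∀ γ : CPath a b n, pev γ a ∈ K₁ → pev γ b ∈ K₂ →
      action L a b γ < cost L a b (pev γ a) (pev γ b) + (ε : EReal) →
      Metric.infDist γ (GammaMin L a b K₁ K₂) < s := by
  by_contra! hcon
  choose γ hγa hγb hact hdist using fun k : ℕ => hcon (1 / ((k : ℝ) + 1)) (by positivity)
  have ha : a ∈ Set.Icc a b := Set.left_mem_Icc.2 hab.le
  have hb : b ∈ Set.Icc a b := Set.right_mem_Icc.2 hab.le
  choose g A hA hAeq using fun k =>
    exists_hasAction_of_action_ne_top hab.le (hact k).ne_top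
  obtain ⟨R₁, hR₁⟩ := hK₁.isBounded.exists_norm_le
  obtain ⟨R₂, hR₂⟩ := hK₂.isBounded.exists_norm_le
  obtain ⟨B, hB⟩ := exists_cost_le hab hL1.continuous (max R₁ R₂)
  have hlt : ∀ (k : ℕ) (T : ℝ), cost L a b (pev (γ k) a) (pev (γ k) b) ≤ (T : EReal) →
      A k ≤ T + 1 / ((k : ℝ) + 1) := by
    intro k T hT
    have h1 := (hact k).le.trans (add_le_add_left hT _)
    rw [hAeq k] at h1
    exact_mod_cast h1
  have hAB : ∀ k, A k ≤ B + 1 := by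
    intro k
    have h1 := hlt k B (hB _ _ ((hR₁ _ (hγa k)).trans (le_max_left _ _))
      ((hR₂ _ (hγb k)).trans (le_max_right _ _)))
    have h2 : 1 / ((k : ℝ) + 1) ≤ 1 := by
      rw [div_le_one (by positivity)]; linarith [k.cast_nonneg (α := ℝ)]
    linarith
  let U : Ultrafilter ℕ := Filter.hyperfilter ℕ
  obtain ⟨γ₀, w, A₀, htend, hA₀, hlsc⟩ := exists_tendsto_of_action_le hL1 hL2 hc₁ hL3 U hA
    (fun k => hR₁ _ (hγa k)) hAB
  have heval : ∀ t ∈ Set.Icc a b, Tendsto (fun k => pev (γ k) t) U (𝓝 (pev γ₀ t)) := by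
    intro t ht
    simp only [pev_of_mem _ ht]
    exact ((continuous_eval_const (⟨t, ht⟩ : Set.Icc a b)).tendsto γ₀).comp htend
  have hmin : γ₀ ∈ GammaMin L a b K₁ K₂ := by
    refine ⟨hA₀.isACC, hK₁.isClosed.mem_of_tendsto (heval a ha) (Eventually.of_forall hγa),
      hK₂.isClosed.mem_of_tendsto (heval b hb) (Eventually.of_forall hγb),
      fun γ' _ hγ'a hγ'b => ?_⟩
    by_cases htop : action L a b γ' = ⊤
    · rw [htop]; exact le_top
    obtain ⟨g', A', hA', hAeq'⟩ := exists_hasAction_of_action_ne_top hab.le htop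
    rw [hA₀.action_eq, hAeq', EReal.coe_le_coe_iff]
    refine le_of_forall_pos_le_add fun ε hε => hlsc _ ?_
    obtain ⟨δ, hδ, hcost⟩ := hA'.eventually_cost_le hab hL1.continuous hc₁.le hL3 (half_pos hε)
    rw [hγ'a, hγ'b] at hcost
    have hsmall : ∀ᶠ k : ℕ in U, 1 / ((k : ℝ) + 1) < ε / 2 :=
      Nat.hyperfilter_le_atTop
        ((tendsto_one_div_add_atTop_nhds_zero_nat).eventually_lt_const (half_pos hε))
    filter_upwards [hsmall, heval a ha (Metric.closedBall_mem_nhds _ hδ),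
      heval b hb (Metric.closedBall_mem_nhds _ hδ)] with k hk hka hkb
    have h1 := hlt k _ (hcost _ _ (mem_closedBall_iff_norm.1 hka) (mem_closedBall_iff_norm.1 hkb))
    linarith
  obtain ⟨k, hk⟩ := (htend.eventually (Metric.ball_mem_nhds γ₀ hs)).exists
  exact absurd (hdist k) (not_le.2 ((Metric.infDist_le_dist_of_mem hmin).trans_lt hk))

end Minimality

/-- A gap function that controls a distance-like function dominates a modulus of it. -/
lemma exists_continuous_modulus {X : Type*} {d gap : X → ℝ} (hgap : ∀ x, 0 ≤ gap x)
    (h : ∀ s, 0 < s → ∃ ε, 0 < ε ∧ ∀ x, gap x < ε → d x < s)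
    {x₀ : X} (hd₀ : d x₀ = 0) (hgap₀ : gap x₀ = 0) :
    ∃ ω : ℝ → ℝ, Continuous ω ∧ ω 0 = 0 ∧ (∀ s, 0 < s → 0 < ω s) ∧ ∀ x, ω (d x) ≤ gap x := by
  have : Nonempty X := ⟨x₀⟩
  have hnn : ∀ s x, 0 ≤ gap x + |s - d x| := fun s x => add_nonneg (hgap x) (abs_nonneg _)
  have hle : ∀ s x, ⨅ x, (gap x + |s - d x|) ≤ gap x + |s - d x| := fun s x =>
    ciInf_le ⟨0, by rintro _ ⟨y, rfl⟩; exact hnn s y⟩ x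
  refine ⟨fun s => ⨅ x, (gap x + |s - d x|), ?_, ?_, fun s hs => ?_, fun x => ?_⟩
  · refine (LipschitzWith.of_le_add fun s t => ?_).continuous
    rw [← sub_le_iff_le_add]
    refine le_ciInf fun x => ?_
    have h1 := hle s x
    have h2 := abs_sub_le s t (d x)
    rw [Real.dist_eq]
    linarith
  · refine le_antisymm ?_ (le_ciInf fun x => hnn 0 x)
    simpa [hd₀, hgap₀] using hle 0 x₀
  · obtain ⟨ε, hε, hεd⟩ := h (s / 2) (half_pos hs)
    refine (lt_min hε (half_pos hs)).trans_le (le_ciInf fun x => ?_)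
    by_cases hx : gap x < ε
    · have h1 := hεd x hx
      have h2 := le_abs_self (s - d x)
      exact (min_le_right _ _).trans (by linarith [hgap x])
    · exact (min_le_left _ _).trans (by linarith [abs_nonneg (s - d x)])
  · simpa using hle (d x) x

lemma exists_continuous_modulus_ereal {X : Type*} {S : Set X} {d c : X → ℝ} {F : X → EReal}
    (hF : ∀ x ∈ S, (c x : EReal) ≤ F x)
    (h : ∀ s, 0 < s → ∃ ε : ℝ, 0 < ε ∧ ∀ x ∈ S, F x < ((c x + ε : ℝ) : EReal) → d x < s)
    {x₀ : X} (hx₀ : x₀ ∈ S) (hd₀ : d x₀ = 0) (hF₀ : F x₀ = (c x₀ : EReal)) :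
    ∃ ω : ℝ → ℝ, Continuous ω ∧ ω 0 = 0 ∧ (∀ s, 0 < s → 0 < ω s) ∧
      ∀ x ∈ S, ((c x + ω (d x) : ℝ) : EReal) ≤ F x := by
  have hreal : ∀ x ∈ S, F x ≠ ⊤ → F x = ((F x).toReal : EReal) := fun x hx hx' =>
    (EReal.coe_toReal hx' ((EReal.bot_lt_coe _).trans_le (hF x hx)).ne').symm
  obtain ⟨ω, hω, hω0, hωpos, hωle⟩ := exists_continuous_modulus
    (X := {x // x ∈ S ∧ F x ≠ ⊤}) (d := fun x => d x) (gap := fun x => (F x).toReal - c x)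
    (fun x => by
      have h1 := hF x x.2.1
      rw [hreal x x.2.1 x.2.2, EReal.coe_le_coe_iff] at h1
      linarith)
    (fun s hs => by
      obtain ⟨ε, hε, hεd⟩ := h s hs
      refine ⟨ε, hε, fun x hx => hεd x x.2.1 ?_⟩
      rw [hreal x x.2.1 x.2.2, EReal.coe_lt_coe_iff]
      linarith)
    (x₀ := ⟨x₀, hx₀, by rw [hF₀]; exact EReal.coe_ne_top _⟩) hd₀ (by simp [hF₀])
  refine ⟨ω, hω, hω0, hωpos, fun x hx => ?_⟩
  by_cases htop : F x = ⊤
  · rw [htop]; exact le_top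
  · have h1 := hωle ⟨x, hx, htop⟩
    rw [hreal x hx htop, EReal.coe_le_coe_iff]
    linarith

/-- **Quantitative minimality (Lemma 3.7).**
If `Γ^min_{K₁,K₂}` is nonempty, there is a continuous modulus `ω` with `ω(0) = 0` and
`ω(s) > 0` for `s > 0` such that every curve `γ` starting in `K₁` and ending in `K₂`
satisfies `𝒜(γ) ≥ c(γ(a),γ(b)) + ω(dist(γ, Γ^min_{K₁,K₂}))`. -/
theorem quantitative_minimality
    {n : ℕ} (hn : 1 ≤ n) {a b : ℝ} (hab : a < b)
    (L : Eu n → Eu n → ℝ)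
    (hL1 : ContDiff ℝ (⊤ : ℕ∞) (Function.uncurry L))
    (hL2 : ∀ K : Set (Eu n), IsCompact K → ∃ c₀ : ℝ, 0 < c₀ ∧
      ∀ x ∈ K, ∀ v w : Eu n, c₀ * ‖w‖ ^ 2 ≤ fderiv ℝ (fderiv ℝ (L x)) v w w)
    (c₁ c₂ : ℝ) (hc₁ : 0 < c₁) (hc₂ : 0 < c₂)
    (hL3 : ∀ x v : Eu n, c₁ * ‖v‖ - c₂ ≤ L x v)
    (K₁ K₂ : Set (Eu n)) (hK₁ : IsCompact K₁) (hK₂ : IsCompact K₂)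
    (hne : (GammaMin L a b K₁ K₂).Nonempty) :
    ∃ ω : ℝ → ℝ, ContinuousOn ω (Set.Ici 0) ∧ ω 0 = 0 ∧ (∀ s : ℝ, 0 < s → 0 < ω s) ∧
      ∀ γ : CPath a b n, pev γ a ∈ K₁ → pev γ b ∈ K₂ →
        cost L a b (pev γ a) (pev γ b) +
            ((ω (Metric.infDist γ (GammaMin L a b K₁ K₂)) : ℝ) : EReal) ≤
          action L a b γ := by
  obtain ⟨σ, hσ⟩ := hne
  have hfin : ∀ x y : Eu n, ∃ c : ℝ, cost L a b x y = (c : EReal) := by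
    intro x y
    obtain ⟨B, hB⟩ := exists_cost_le hab hL1.continuous (max ‖x‖ ‖y‖)
    have h1 := ((hB x y (le_max_left _ _) (le_max_right _ _)).trans_lt (EReal.coe_lt_top B)).ne
    have h2 := ((EReal.bot_lt_coe _).trans_le (neg_le_cost hab.le hc₁.le hL3 x y)).ne'
    exact ⟨_, (EReal.coe_toReal h1 h2).symm⟩
  choose C hC using hfin
  obtain ⟨ω, hω, hω0, hωpos, hωle⟩ := exists_continuous_modulus_ereal
    (S := {γ : CPath a b n | pev γ a ∈ K₁ ∧ pev γ b ∈ K₂}) (F := action L a b)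
    (c := fun γ => C (pev γ a) (pev γ b))
    (d := fun γ => Metric.infDist γ (GammaMin L a b K₁ K₂))
    (fun γ _ => (hC _ _).symm.trans_le cost_le_action)
    (fun s hs => by
      obtain ⟨ε, hε, h⟩ := exists_infDist_lt_of_action_lt hab hL1 hL2 hc₁ hL3 hK₁ hK₂ hs
      refine ⟨ε, hε, fun γ hγ hlt => h γ hγ.1 hγ.2 ?_⟩
      rwa [hC, ← EReal.coe_add])
    ⟨hσ.2.1, hσ.2.2.1⟩ (Metric.infDist_zero_of_mem hσ) ((action_eq_cost hσ).trans (hC _ _))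
  refine ⟨ω, hω.continuousOn, hω0, hωpos, fun γ hγa hγb => ?_⟩
  rw [hC, ← EReal.coe_add]
  exact hωle γ ⟨hγa, hγb⟩
end

section
/- (Trajectory bound via the action, Lemma 6.1.) Assume b − a ≤ √(c₁/(4c₂)). For every compact set K ⊆ ℝⁿ and every constant C > 0 there exists a constant c = c(c₁,c₂,K,C) > 0 such that every absolutely continuous curve γ : [a,b] → ℝⁿ with γ(a) ∈ K and 𝒜(γ) ≤ C satisfies ‖γ(t) − x₀‖ ≤ c for all t ∈ [a,b]. -/
open MeasureTheory Filter Topology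
open scoped ENNReal NNReal

/-- The `L¹` norm of the velocity is controlled by any upper bound `C` of the integral of a
Lagrangian that dominates `c₁ ‖v‖² - k`. -/
lemma mul_sq_integral_norm_le {E : Type*} [NormedAddCommGroup E] {a b : ℝ} (hab : a < b)
    {g : ℝ → E} {ℓ : ℝ → ℝ} {c₁ k C : ℝ}
    (hg : IntegrableOn g (Set.Icc a b)) (hℓ : IntegrableOn ℓ (Set.Icc a b))
    (hle : ∀ t ∈ Set.Icc a b, c₁ * ‖g t‖ ^ 2 - k ≤ ℓ t) (hc₁ : 0 ≤ c₁)
    (hC : ∫ t in Set.Icc a b, ℓ t ≤ C) :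
    c₁ * (∫ t in Set.Icc a b, ‖g t‖) ^ 2 ≤ (b - a) * (C + k * (b - a)) := by
  set G := ∫ t in Set.Icc a b, ‖g t‖ with hG
  have hT : 0 < b - a := sub_pos.2 hab
  set s := G / (b - a)
  have hsG : s * (b - a) = G := div_mul_cancel₀ _ hT.ne'
  have hconst : IntegrableOn (fun _ : ℝ => c₁ * s ^ 2 + k) (Set.Icc a b) := by simp
  have hlin : IntegrableOn (fun t => c₁ * (2 * s) * ‖g t‖) (Set.Icc a b) :=
    hg.norm.const_mul _
  have hmono : ∫ t in Set.Icc a b, (c₁ * (2 * s) * ‖g t‖ - (c₁ * s ^ 2 + k)) ≤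
      ∫ t in Set.Icc a b, ℓ t := by
    refine setIntegral_mono_on (hlin.sub hconst) hℓ measurableSet_Icc fun t ht => ?_
    have := mul_nonneg hc₁ (sq_nonneg (‖g t‖ - s))
    nlinarith [hle t ht]
  rw [integral_sub hlin hconst, integral_const_mul, ← hG, setIntegral_const,
    Real.volume_real_Icc_of_le hab.le, smul_eq_mul] at hmono
  rw [← hsG] at hmono ⊢
  nlinarith [mul_le_mul_of_nonneg_left (hmono.trans hC) hT.le]

lemma pev_apply {a b : ℝ} {n : ℕ} (γ : CPath a b n) {t : ℝ} (ht : t ∈ Set.Icc a b) :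
    pev γ t = γ ⟨t, ht⟩ :=
  dif_pos ht

/-- A curve of finite action has an integrable velocity along which the Lagrangian is
integrable, with integral at most any real upper bound of the action. -/
lemma exists_velocity_of_action_le {n : ℕ} {L : Eu n → Eu n → ℝ} {a b : ℝ} {γ : CPath a b n}
    {C : ℝ} (hA : action L a b γ ≤ (C : EReal)) :
    ∃ g : ℝ → Eu n, IntegrableOn g (Set.Icc a b) ∧
      (∀ s t : Set.Icc a b, γ t = γ s + ∫ u in (s : ℝ)..(t : ℝ), g u) ∧
      IntegrableOn (fun t => L (pev γ t) (g t)) (Set.Icc a b) ∧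
      ∫ t in Set.Icc a b, L (pev γ t) (g t) ≤ C := by
  unfold action at hA
  split_ifs at hA with h hint
  · exact ⟨h.choose, h.choose_spec.1, h.choose_spec.2, hint, EReal.coe_le_coe_iff.1 hA⟩
  · simp at hA
  · simp at hA

/-- **Trajectory bound via the action (Lemma 6.1).**
Under the quadratic growth condition `L(x,v) ≥ c₁|v|² − c₂(1+|x−x₀|²)` and for short times
`b − a ≤ √(c₁/(4c₂))`, for every compact `K` and `C > 0` there is a constant `c` such that
every absolutely continuous curve starting in `K` with action at most `C` stays within
distance `c` of `x₀` on all of `[a,b]`. -/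
theorem trajectory_bound_via_action
    {n : ℕ} (hn : 1 ≤ n) {a b : ℝ} (hab : a < b)
    (L : Eu n → Eu n → ℝ)
    (c₁ c₂ : ℝ) (hc₁ : 0 < c₁) (hc₂ : 0 < c₂) (x₀ : Eu n)
    (hL3 : ∀ x v : Eu n, c₁ * ‖v‖ ^ 2 - c₂ * (1 + ‖x - x₀‖ ^ 2) ≤ L x v)
    (htime : b - a ≤ Real.sqrt (c₁ / (4 * c₂)))
    (K : Set (Eu n)) (hK : IsCompact K) (C : ℝ) (hC : 0 < C) :
    ∃ c : ℝ, 0 < c ∧ ∀ γ : CPath a b n, IsACC γ → pev γ a ∈ K →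
      action L a b γ ≤ (C : EReal) → ∀ t ∈ Set.Icc a b, ‖pev γ t - x₀‖ ≤ c := by
  obtain ⟨R, hR⟩ := hK.isBounded.subset_closedBall x₀
  have hT : 0 < b - a := sub_pos.2 hab
  set D := Real.sqrt (((b - a) * C + c₁ / 4) / c₁)
  have hD : 0 ≤ D := Real.sqrt_nonneg _
  have hDsq : c₁ * D ^ 2 = (b - a) * C + c₁ / 4 := by
    rw [Real.sq_sqrt (by positivity), mul_div_cancel₀ _ hc₁.ne']
  have hTsq : c₂ * (b - a) ^ 2 ≤ c₁ / 4 := by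
    have h := (Real.le_sqrt hT.le (by positivity)).1 htime
    rw [le_div_iff₀ (by positivity)] at h
    linarith
  refine ⟨max 1 (2 * (R + D)), by positivity, fun γ _ hγa hA t ht => le_max_of_le_right ?_⟩
  obtain ⟨g, hg, hγ, hint, hle⟩ := exists_velocity_of_action_le hA
  have haI : a ∈ Set.Icc a b := Set.left_mem_Icc.2 hab.le
  have : Nonempty (Set.Icc a b) := ⟨⟨a, haI⟩⟩
  obtain ⟨τ, -, hτ⟩ := isCompact_univ.exists_isMaxOn Set.univ_nonempty
    (by fun_prop : ContinuousOn (fun s => ‖γ s - x₀‖) Set.univ)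
  replace hτ : ∀ s, ‖γ s - x₀‖ ≤ ‖γ τ - x₀‖ := fun s => hτ (Set.mem_univ s)
  set M := ‖γ τ - x₀‖ with hM
  rw [pev_apply γ ht]
  refine (hτ _).trans ?_
  have hM0 : 0 ≤ M := norm_nonneg _
  set G := ∫ t in Set.Icc a b, ‖g t‖ with hG
  have hG_le : c₁ * G ^ 2 ≤ (b - a) * (C + c₂ * (1 + M ^ 2) * (b - a)) := by
    refine mul_sq_integral_norm_le hab hg hint (fun s hs => ?_) hc₁.le hle
    refine le_trans ?_ (hL3 _ _)
    have : ‖pev γ s - x₀‖ ≤ M := by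
      rw [pev_apply γ hs]
      exact hτ _
    gcongr
  have hGM : G ≤ D + M / 2 := by
    refine le_of_abs_le (abs_le_of_sq_le_sq ?_ (by positivity))
    refine le_of_mul_le_mul_left ?_ hc₁
    have h1 := mul_le_mul_of_nonneg_right hTsq (by positivity : (0 : ℝ) ≤ 1 + M ^ 2)
    have h2 : 0 ≤ c₁ * (D * M) := by positivity
    nlinarith
  have hMR : M ≤ R + G := by
    have hγaR : ‖γ ⟨a, haI⟩ - x₀‖ ≤ R := by
      rw [← pev_apply γ haI, ← dist_eq_norm]
      exact hR hγa
    have hstep : ‖∫ u in a..(τ : ℝ), g u‖ ≤ G := by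
      refine (intervalIntegral.norm_integral_le_integral_norm τ.2.1).trans ?_
      rw [intervalIntegral.integral_of_le τ.2.1]
      refine setIntegral_mono_set hg.norm (ae_of_all _ fun _ => norm_nonneg _) ?_
      exact (Set.Ioc_subset_Icc_self.trans (Set.Icc_subset_Icc_right τ.2.2)).eventuallyLE
    rw [hM, hγ ⟨a, haI⟩ τ, add_sub_right_comm]
    exact (norm_add_le _ _).trans (add_le_add hγaR hstep)
  linarith
end

section
/- (Midpoint-rule error estimate, Lemma 7.2.) For every curve γ ∈ C([a,b];ℝⁿ) that is piecewise affine subordinate to the partition, | ∫_a^b V(γ(t)) dt − ∑_{j=1}^l V((γ(τ_j)+γ(τ_{j−1}))/2)·(τ_j − τ_{j−1}) | ≤ h² · sup_{t∈[a,b]} ‖D²V(γ(t))‖ · ∑_{j=1}^l ‖γ(τ_j) − γ(τ_{j−1})‖²/(τ_j − τ_{j−1}), where ‖D²V(x)‖ denotes the operator norm of the Hessian of V at x and ∑_{j=1}^l ‖γ(τ_j) − γ(τ_{j−1})‖²/(τ_j − τ_{j−1}) = ∫_a^b ‖γ̇(t)‖² dt. -/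
open MeasureTheory Filter Topology
open scoped ENNReal NNReal

open Set in
/-- A function whose second derivative is bounded by `K` on `[c, d]` has midpoint-rule error at
most `K (d - c) ^ 3`. -/
theorem abs_integral_sub_midpoint_le {g g' g'' : ℝ → ℝ} {c d K : ℝ} (hcd : c ≤ d)
    (hg : ∀ t ∈ Icc c d, HasDerivWithinAt g (g' t) (Icc c d) t)
    (hg' : ∀ t ∈ Icc c d, HasDerivWithinAt g' (g'' t) (Icc c d) t)
    (hK : ∀ t ∈ Icc c d, |g'' t| ≤ K) :
    |(∫ t in c..d, g t) - g ((c + d) / 2) * (d - c)| ≤ K * (d - c) ^ 3 := by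
  set m := (c + d) / 2 with hm
  have hmem : m ∈ Icc c d := ⟨by linarith, by linarith⟩
  have hK0 : 0 ≤ K := (abs_nonneg _).trans (hK m hmem)
  have hdist : ∀ t ∈ Icc c d, |t - m| ≤ d - c := fun t ht =>
    abs_le.2 ⟨by linarith [ht.1, ht.2], by linarith [ht.1, ht.2]⟩
  have hlip : ∀ t ∈ Icc c d, ‖g' t - g' m‖ ≤ K * (d - c) := fun t ht =>
    ((convex_Icc c d).norm_image_sub_le_of_norm_hasDerivWithin_le hg' hK hmem ht).trans
      (mul_le_mul_of_nonneg_left (hdist t ht) hK0)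
  have htaylor : ∀ t ∈ Icc c d, |g t - g m - g' m * (t - m)| ≤ K * (d - c) ^ 2 := by
    intro t ht
    have hderiv : ∀ s ∈ Icc c d,
        HasDerivWithinAt (fun s => g s - g' m * s) (g' s - g' m) (Icc c d) s := fun s hs => by
      simpa using! (hg s hs).sub ((hasDerivWithinAt_id s _).const_mul (g' m))
    have := (convex_Icc c d).norm_image_sub_le_of_norm_hasDerivWithin_le hderiv hlip hmem ht
    calc |g t - g m - g' m * (t - m)| = ‖g t - g' m * t - (g m - g' m * m)‖ := by
          rw [Real.norm_eq_abs]; ring_nf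
      _ ≤ K * (d - c) * |t - m| := this
      _ ≤ K * (d - c) * (d - c) :=
          mul_le_mul_of_nonneg_left (hdist t ht) (mul_nonneg hK0 (sub_nonneg.2 hcd))
      _ = K * (d - c) ^ 2 := by ring
  have hint : IntervalIntegrable g volume c d :=
    ContinuousOn.intervalIntegrable_of_Icc hcd fun t ht => (hg t ht).continuousWithinAt
  have heq : (∫ t in c..d, g t) - g m * (d - c) = ∫ t in c..d, (g t - g m - g' m * (t - m)) := by
    have hlin : Continuous fun t : ℝ => g' m * (t - m) := by fun_prop
    rw [intervalIntegral.integral_sub (hint.sub intervalIntegrable_const)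
        (hlin.intervalIntegrable _ _),
      intervalIntegral.integral_sub hint intervalIntegrable_const,
      intervalIntegral.integral_const_mul,
      intervalIntegral.integral_sub intervalIntegral.intervalIntegrable_id
        intervalIntegrable_const]
    simp only [intervalIntegral.integral_const, integral_id, smul_eq_mul, hm]
    ring
  rw [heq]
  have := intervalIntegral.norm_integral_le_of_norm_le_const (a := c) (b := d)
    (f := fun t => g t - g m - g' m * (t - m)) (C := K * (d - c) ^ 2) fun t ht =>
      htaylor t (Ioc_subset_Icc_self (uIoc_of_le hcd ▸ ht))
  rw [Real.norm_eq_abs, abs_of_nonneg (sub_nonneg.2 hcd)] at this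
  linarith

open Set in
/-- Midpoint-rule error for a `C²` function along an affine segment. -/
theorem abs_integral_comp_affine_sub_midpoint_le {E : Type*} [NormedAddCommGroup E]
    [NormedSpace ℝ E] {V : E → ℝ} (hV : ContDiff ℝ 2 V) {c d M : ℝ} (hcd : c < d) (p q : E)
    (hM : ∀ t ∈ Icc c d,
      ‖fderiv ℝ (fderiv ℝ V) (p + ((t - c) / (d - c)) • (q - p))‖ ≤ M) :
    |(∫ t in c..d, V (p + ((t - c) / (d - c)) • (q - p))) - V ((2 : ℝ)⁻¹ • (q + p)) * (d - c)|
      ≤ M * (d - c) * ‖q - p‖ ^ 2 := by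
  have hδ : 0 < d - c := sub_pos.2 hcd
  set w : E := (d - c)⁻¹ • (q - p) with hw
  set f : ℝ → E := fun t => p + ((t - c) / (d - c)) • (q - p) with hf
  have hfd : ∀ t, HasDerivAt f w t := fun t => by
    simpa [hf, hw] using
      ((((hasDerivAt_id t).sub_const c).div_const (d - c)).smul_const (q - p)).const_add p
  have hV' : ContDiff ℝ 1 (fderiv ℝ V) := hV.fderiv_right (by norm_num)
  have h1 : ∀ t, HasDerivAt (fun t => V (f t)) (fderiv ℝ V (f t) w) t := fun t =>
    ((hV.differentiable (by norm_num) (f t)).hasFDerivAt).comp_hasDerivAt t (hfd t)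
  have h2 : ∀ t, HasDerivAt (fun t => fderiv ℝ V (f t) w)
      (fderiv ℝ (fderiv ℝ V) (f t) w w) t := fun t => by
    simpa using (((hV'.differentiable (by norm_num) (f t)).hasFDerivAt).comp_hasDerivAt t
      (hfd t)).clm_apply (hasDerivAt_const t w)
  have hmid : f ((c + d) / 2) = (2 : ℝ)⁻¹ • (q + p) := by
    have : ((c + d) / 2 - c) / (d - c) = (2 : ℝ)⁻¹ := by field_simp; ring
    simp only [hf, this]
    module
  have := abs_integral_sub_midpoint_le hcd.le (K := M * ‖w‖ ^ 2)
    (fun t _ => (h1 t).hasDerivWithinAt) (fun t _ => (h2 t).hasDerivWithinAt) fun t ht => by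
      calc |fderiv ℝ (fderiv ℝ V) (f t) w w| ≤ ‖fderiv ℝ (fderiv ℝ V) (f t)‖ * ‖w‖ * ‖w‖ :=
            (fderiv ℝ (fderiv ℝ V) (f t)).le_opNorm₂ w w
        _ ≤ M * ‖w‖ * ‖w‖ := by gcongr; exact hM t ht
        _ = M * ‖w‖ ^ 2 := by ring
  rw [hmid] at this
  refine this.trans_eq ?_
  rw [hw, norm_smul, norm_inv, Real.norm_of_nonneg hδ.le]
  field_simp

/-- **Midpoint-rule error estimate (Lemma 7.2).**
For every piecewise affine curve `γ` subordinate to the partition, the midpoint rule for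
`∫_a^b V(γ(t)) dt` has error at most
`h² · sup_{t∈[a,b]} ‖D²V(γ(t))‖ · ∑_j ‖γ(τ_j) − γ(τ_{j−1})‖²/(τ_j − τ_{j−1})`. -/
theorem midpoint_rule_error_estimate
    {n : ℕ} (hn : 1 ≤ n) {a b : ℝ} (hab : a < b)
    (V : Eu n → ℝ) (hV1 : ContDiff ℝ (⊤ : ℕ∞) V)
    (h : ℝ) (hpos : 0 < h) (l : ℕ) (τ : ℕ → ℝ) (hpart : IsPartition a b τ l h)
    (γ : CPath a b n) (hPA : PiecewiseAffine a b τ l γ) :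
    |(∫ t in a..b, V (pev γ t)) -
        ∑ j ∈ Finset.range l,
          V ((2 : ℝ)⁻¹ • (pev γ (τ (j + 1)) + pev γ (τ j))) * (τ (j + 1) - τ j)| ≤
      h ^ 2 * (⨆ t : Set.Icc a b, ‖fderiv ℝ (fderiv ℝ V) (γ t)‖) *
        ∑ j ∈ Finset.range l, ‖pev γ (τ (j + 1)) - pev γ (τ j)‖ ^ 2 / (τ (j + 1) - τ j) := by
  obtain ⟨-, h0, hl, hlt, hmesh⟩ := hpart
  set M := ⨆ t : Set.Icc a b, ‖fderiv ℝ (fderiv ℝ V) (γ t)‖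
  have hV2 : ContDiff ℝ 2 V := contDiff_infty.1 hV1 2
  have hcont : Continuous fun t : Set.Icc a b => ‖fderiv ℝ (fderiv ℝ V) (γ t)‖ :=
    (((hV2.fderiv_right (m := 1) (by norm_num)).continuous_fderiv (by norm_num)).comp
      γ.continuous).norm
  have hM : ∀ t : Set.Icc a b, ‖fderiv ℝ (fderiv ℝ V) (γ t)‖ ≤ M :=
    le_ciSup (isCompact_range hcont).bddAbove
  have hM0 : 0 ≤ M := Real.iSup_nonneg fun t => norm_nonneg (fderiv ℝ (fderiv ℝ V) (γ t))
  have hmono : ∀ i j, i ≤ j → j ≤ l → τ i ≤ τ j := by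
    intro i j hij
    induction j, hij using Nat.le_induction with
    | base => exact fun _ => le_rfl
    | succ k _ ih => exact fun hk => (ih (by omega)).trans (hlt k (by omega)).le
  have hsub : ∀ j < l, Set.Icc (τ j) (τ (j + 1)) ⊆ Set.Icc a b := fun j hj =>
    Set.Icc_subset_Icc (h0 ▸ hmono 0 j (by omega) hj.le) (hl ▸ hmono (j + 1) l hj le_rfl)
  have haff : ∀ j (hj : j < l) t (ht : t ∈ Set.Icc (τ j) (τ (j + 1))),
      γ ⟨t, hsub j hj ht⟩ = pev γ (τ j) + ((t - τ j) / (τ (j + 1) - τ j)) •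
        (pev γ (τ (j + 1)) - pev γ (τ j)) := fun j hj t ht => hPA j hj ⟨t, hsub j hj ht⟩ ht
  have hpev : ∀ j < l, ∀ t ∈ Set.Icc (τ j) (τ (j + 1)),
      pev γ t = pev γ (τ j) + ((t - τ j) / (τ (j + 1) - τ j)) •
        (pev γ (τ (j + 1)) - pev γ (τ j)) := fun j hj t ht => by
    rw [← haff j hj t ht, pev, dif_pos (hsub j hj ht)]
  have hint : ∀ j < l, IntervalIntegrable (fun t => V (pev γ t)) volume (τ j) (τ (j + 1)) := by
    intro j hj
    refine ContinuousOn.intervalIntegrable_of_Icc (hlt j hj).le ?_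
    refine (Continuous.continuousOn ?_).congr fun t ht => congrArg V (hpev j hj t ht)
    exact hV2.continuous.comp (by fun_prop)
  have hsum := intervalIntegral.sum_integral_adjacent_intervals hint
  rw [h0, hl] at hsum
  rw [← hsum, ← Finset.sum_sub_distrib, Finset.mul_sum]
  refine (Finset.abs_sum_le_sum_abs _ _).trans (Finset.sum_le_sum fun j hj => ?_)
  rw [Finset.mem_range] at hj
  have hδ : 0 < τ (j + 1) - τ j := sub_pos.2 (hlt j hj)
  rw [intervalIntegral.integral_congr fun t ht =>
    congrArg V (hpev j hj t (Set.uIcc_of_le (hlt j hj).le ▸ ht))]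
  refine (abs_integral_comp_affine_sub_midpoint_le hV2 (hlt j hj) _ _ fun t ht =>
    haff j hj t ht ▸ hM ⟨t, hsub j hj ht⟩).trans ?_
  calc M * (τ (j + 1) - τ j) * ‖pev γ (τ (j + 1)) - pev γ (τ j)‖ ^ 2
      = (τ (j + 1) - τ j) ^ 2 * M *
        (‖pev γ (τ (j + 1)) - pev γ (τ j)‖ ^ 2 / (τ (j + 1) - τ j)) := by field_simp
    _ ≤ h ^ 2 * M * (‖pev γ (τ (j + 1)) - pev γ (τ j)‖ ^ 2 / (τ (j + 1) - τ j)) := by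
      gcongr
      exact hmesh j hj
end

section
/- (Discrete stationary points shadow continuous extremals, Lemma 7.6.) For all R, C > 0 there exist constants c = c(m,V,a,b,R,C) > 0 and h₀ > 0 with the following property. Let 0 < h ≤ h₀, let a = τ₀ < … < τ_l = b be a partition with mesh at most h, and let γ be piecewise affine subordinate to the partition, satisfying the discrete Euler–Lagrange equations, with ‖γ(t)‖ ≤ R for all t ∈ [a,b] and 𝒜^{[h]}(γ) ≤ C. Let γ̃ : [a,b] → ℝⁿ be a twice continuously differentiable curve with m γ̃''(t) = −∇V(γ̃(t)) for all t ∈ [a,b], γ̃(a) = γ(a) and γ̃'(a) = (γ(τ₁) − γ(a))/(τ₁ − a). Then ‖γ(t) − γ̃(t)‖ ≤ c·h for all t ∈ [a,b], and ‖γ'(t) − γ̃'(t)‖ ≤ c·h for every t in the interior of each partition interval, where γ'(t) denotes the (constant) slope of γ on that interval. -/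
open MeasureTheory Filter Topology
open scoped ENNReal NNReal

open Set

theorem gronwallBound_gronwallBound {δ K ε : ℝ} (hK : K ≠ 0) (x y : ℝ) :
    gronwallBound (gronwallBound δ K ε x) K ε y = gronwallBound δ K ε (x + y) := by
  simp only [gronwallBound_of_K_ne_0 hK, mul_add, Real.exp_add]
  ring

theorem gronwallBound_mul (d δ K ε x : ℝ) :
    gronwallBound (d * δ) K (d * ε) x = d * gronwallBound δ K ε x := by
  unfold gronwallBound
  split_ifs <;> ring

theorem hasDerivAt_deriv_deriv {E : Type*} [NormedAddCommGroup E] [NormedSpace ℝ E] {f : ℝ → E}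
    (hf : ContDiff ℝ 2 f) (t : ℝ) :
    HasDerivAt f (deriv f t) t ∧ HasDerivAt (deriv f) (deriv (deriv f) t) t :=
  ⟨(hf.differentiable two_ne_zero t).hasDerivAt,
    ((ContDiff.deriv' (n := 1) hf).differentiable one_ne_zero t).hasDerivAt⟩

section Newton

variable {E : Type*} [NormedAddCommGroup E] [InnerProductSpace ℝ E] [CompleteSpace E]

theorem ContDiff.gradient_one {V : E → ℝ} (hV : ContDiff ℝ 2 V) : ContDiff ℝ 1 (gradient V) :=
  (InnerProductSpace.toDual ℝ E).symm.contDiff.comp (hV.fderiv_right (m := 1) (by norm_num))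

variable {m a b : ℝ} {V : E → ℝ} {f : ℝ → E}

/-- Conservation of energy along solutions of Newton's equation. -/
theorem newton_energy_eq (hV : Differentiable ℝ V) (hf : ContDiff ℝ 2 f)
    (hN : ∀ t ∈ Icc a b, m • deriv (deriv f) t = -gradient V (f t)) {t : ℝ} (ht : t ∈ Icc a b) :
    m / 2 * ‖deriv f t‖ ^ 2 + V (f t) = m / 2 * ‖deriv f a‖ ^ 2 + V (f a) := by
  have hd : ∀ t, HasDerivAt (fun t => m / 2 * ‖deriv f t‖ ^ 2 + V (f t))
      (m / 2 * (2 * inner ℝ (deriv f t) (deriv (deriv f) t)) +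
        inner ℝ (gradient V (f t)) (deriv f t)) t := by
    intro t
    obtain ⟨h1, h2⟩ := hasDerivAt_deriv_deriv hf t
    refine (h2.norm_sq.const_mul (m / 2)).add ?_
    have h3 := (hV (f t)).hasFDerivAt.comp_hasDerivAt t h1
    rwa [← inner_gradient_left] at h3
  refine constant_of_has_deriv_right_zero (f := fun t => m / 2 * ‖deriv f t‖ ^ 2 + V (f t))
    (fun t _ => (hd t).continuousAt.continuousWithinAt) (fun t ht => ?_) t ht
  have h0 := hN t (Ico_subset_Icc_self ht)
  have h4 : m * inner ℝ (deriv f t) (deriv (deriv f) t) +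
      inner ℝ (gradient V (f t)) (deriv f t) = 0 := by
    rw [← real_inner_smul_right, h0, inner_neg_right,
      real_inner_comm, neg_add_cancel]
  have h5 := (hd t).hasDerivWithinAt (s := Ici t)
  convert h5 using 1
  linarith

/-- Solutions of Newton's equation for a potential of at most quadratic growth stay in a ball
controlled by the initial data. -/
theorem newton_norm_le (hm : 0 < m) (hV : Differentiable ℝ V) {c₂ : ℝ} (hc₂ : 0 ≤ c₂)
    (hV2 : ∀ x, |V x| ≤ c₂ * (1 + ‖x‖ ^ 2)) (hf : ContDiff ℝ 2 f)
    (hN : ∀ t ∈ Icc a b, m • deriv (deriv f) t = -gradient V (f t)) {R M : ℝ} (hR : 0 ≤ R)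
    (hfa : ‖f a‖ ≤ R) (hfa' : ‖deriv f a‖ ≤ M) {t : ℝ} (ht : t ∈ Icc a b) :
    ‖f t‖ ≤ gronwallBound R √(2 / m * c₂)
      √(2 / m * (m / 2 * M ^ 2 + c₂ * (1 + R ^ 2) + c₂)) (b - a) := by
  have hle := norm_le_gronwallBound_of_norm_deriv_right_le (f := f) (f' := deriv f) (a := a)
    (b := b) (δ := R) (K := √(2 / m * c₂))
    (ε := √(2 / m * (m / 2 * M ^ 2 + c₂ * (1 + R ^ 2) + c₂))) hf.continuous.continuousOn
    (fun t _ => (hasDerivAt_deriv_deriv hf t).1.hasDerivWithinAt) hfa (fun t ht => ?_) t ht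
  · exact hle.trans (gronwallBound_mono hR (Real.sqrt_nonneg _) (Real.sqrt_nonneg _)
      (by linarith [ht.2]))
  have hen := newton_energy_eq hV hf hN (Ico_subset_Icc_self ht)
  have h1 := (abs_le.mp (hV2 (f t))).1
  have h2 := (abs_le.mp (hV2 (f a))).2
  have h3 : ‖f a‖ ^ 2 ≤ R ^ 2 := by gcongr
  have h4 : ‖deriv f a‖ ^ 2 ≤ M ^ 2 := by gcongr
  have h5 : m / 2 * ‖deriv f t‖ ^ 2 ≤
      m / 2 * M ^ 2 + c₂ * (1 + R ^ 2) + c₂ + c₂ * ‖f t‖ ^ 2 := by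
    have h6 := mul_le_mul_of_nonneg_left h3 hc₂
    have h7 := mul_le_mul_of_nonneg_left h4 (half_pos hm).le
    linarith
  have h6 : ‖deriv f t‖ ^ 2 ≤ 2 / m * c₂ * ‖f t‖ ^ 2 +
      2 / m * (m / 2 * M ^ 2 + c₂ * (1 + R ^ 2) + c₂) := by
    have h7 := mul_le_mul_of_nonneg_left h5 (by positivity : 0 ≤ 2 / m)
    have h8 : 2 / m * (m / 2 * ‖deriv f t‖ ^ 2) = ‖deriv f t‖ ^ 2 := by field_simp
    linarith
  refine (Real.le_sqrt_of_sq_le h6).trans (Real.sqrt_le_iff.mpr ⟨by positivity, ?_⟩)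
  have h7 := Real.sq_sqrt (by positivity : 0 ≤ 2 / m * c₂)
  have h8 := Real.sq_sqrt
    (by positivity : 0 ≤ 2 / m * (m / 2 * M ^ 2 + c₂ * (1 + R ^ 2) + c₂))
  rw [add_sq, mul_pow, h7, h8]
  have : 0 ≤ 2 * (√(2 / m * c₂) * ‖f t‖) *
      √(2 / m * (m / 2 * M ^ 2 + c₂ * (1 + R ^ 2) + c₂)) := by positivity
  linarith

end Newton

/-- One step of the comparison: on `[s,e]`, the affine path `x₀ + (t - s) v` together with the
affine velocity through `v` at the midpoint is an approximate solution of `x'' = F x`. -/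
theorem dist_midpoint_step_le {E : Type*} [NormedAddCommGroup E] [NormedSpace ℝ E]
    {F : E → E} {S : Set E} {L : ℝ≥0} (hF : LipschitzOnWith L F S)
    {s e h G M δ : ℝ} (hse : s ≤ e) (heh : e - s ≤ h) {x₀ v q : E} (hv : ‖v‖ ≤ M) (hG : ‖q‖ ≤ G)
    (hx : ∀ t ∈ Icc s e, x₀ + (t - s) • v ∈ S) (hq : q = F (x₀ + ((s + e) / 2 - s) • v))
    {f f' : ℝ → E} (hf : ∀ t ∈ Icc s e, HasDerivAt f (f' t) t)
    (hf' : ∀ t ∈ Icc s e, HasDerivAt f' (F (f t)) t) (hfS : ∀ t ∈ Icc s e, f t ∈ S)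
    (hs : dist (x₀, v + (s - (s + e) / 2) • q) (f s, f' s) ≤ δ) :
    ∀ t ∈ Icc s e, dist (x₀ + (t - s) • v, v + (t - (s + e) / 2) • q) (f t, f' t) ≤
      gronwallBound δ (max 1 L : ℝ≥0) ((G + L * M) * h) (t - s) := by
  have hM : 0 ≤ M := (norm_nonneg v).trans hv
  have hG0 : 0 ≤ G := (norm_nonneg q).trans hG
  have hh : 0 ≤ h := by linarith
  have hlip : LipschitzOnWith (max 1 L) (fun z : E × E => (z.2, F z.1)) (Prod.fst ⁻¹' S) := by
    refine LipschitzOnWith.prodMk LipschitzWith.prod_snd.lipschitzOnWith ?_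
    simpa [Function.comp_def] using hF.comp
      (LipschitzWith.prod_fst.lipschitzOnWith (s := Prod.fst ⁻¹' S)) (mapsTo_preimage _ _)
  have hcurve : ∀ t, HasDerivAt (fun t => (x₀ + (t - s) • v, v + (t - (s + e) / 2) • q))
      (v, q) t := by
    intro t
    have h1 : ∀ c : ℝ, ∀ y z : E, HasDerivAt (fun t : ℝ => y + (t - c) • z) z t := by
      intro c y z
      simpa using (((hasDerivAt_id t).sub_const c).smul_const z).const_add y
    exact (h1 _ _ _).prodMk (h1 _ _ _)
  have hsol : ∀ t ∈ Icc s e, HasDerivAt (fun t => (f t, f' t)) (f' t, F (f t)) t :=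
    fun t ht => (hf t ht).prodMk (hf' t ht)
  have hmain := dist_le_of_approx_trajectories_ODE_of_mem (a := s) (b := e) (δ := δ)
    (v := fun _ z => (z.2, F z.1)) (s := fun _ => Prod.fst ⁻¹' S)
    (f := fun t => (x₀ + (t - s) • v, v + (t - (s + e) / 2) • q)) (f' := fun _ => (v, q))
    (g := fun t => (f t, f' t)) (g' := fun t => (f' t, F (f t)))
    (εf := (G + L * M) * h) (εg := 0) (fun _ _ => hlip)
    (fun t _ => (hcurve t).continuousAt.continuousWithinAt)
    (fun t _ => (hcurve t).hasDerivWithinAt) (fun t ht => ?_)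
    (fun t ht => hx t (Ico_subset_Icc_self ht))
    (fun t ht => (hsol t ht).continuousAt.continuousWithinAt)
    (fun t ht => (hsol t (Ico_subset_Icc_self ht)).hasDerivWithinAt) (fun t _ => by simp)
    (fun t ht => hfS t (Ico_subset_Icc_self ht)) (by simpa using hs)
  · simpa only [add_zero] using hmain
  have habs : |t - (s + e) / 2| ≤ h := by
    rw [abs_le]; constructor <;> linarith [ht.1, ht.2]
  rw [Prod.dist_eq]
  refine max_le ?_ ?_
  · rw [dist_eq_norm, sub_add_cancel_left, norm_neg, norm_smul, Real.norm_eq_abs]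
    calc |t - (s + e) / 2| * ‖q‖ ≤ h * G := by gcongr
      _ ≤ (G + L * M) * h := by
        have : 0 ≤ L * M * h := by positivity
        linarith
  · have h1 := hF.dist_le_mul _ (hx ((s + e) / 2) ⟨by linarith, by linarith⟩) _
      (hx t (Ico_subset_Icc_self ht))
    rw [← hq] at h1
    refine h1.trans ?_
    rw [dist_eq_norm, add_sub_add_left_eq_sub, ← sub_smul, norm_smul, Real.norm_eq_abs,
      sub_sub_sub_cancel_right, abs_sub_comm]
    calc L * (|t - (s + e) / 2| * ‖v‖) ≤ L * (h * M) := by gcongr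
      _ ≤ (G + L * M) * h := by
        have : 0 ≤ G * h := by positivity
        linarith

theorem IsPartition.le_of_le {a b h : ℝ} {τ : ℕ → ℝ} {l : ℕ} (hτ : IsPartition a b τ l h)
    {i j : ℕ} (hij : i ≤ j) (hj : j ≤ l) : τ i ≤ τ j := by
  induction j, hij using Nat.le_induction with
  | base => exact le_rfl
  | succ k _ ih => exact (ih (by omega)).trans (hτ.2.2.2.1 k (by omega)).le

theorem IsPartition.mem_Icc {a b h : ℝ} {τ : ℕ → ℝ} {l : ℕ} (hτ : IsPartition a b τ l h)
    {j : ℕ} (hj : j ≤ l) : τ j ∈ Icc a b :=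
  ⟨hτ.2.1 ▸ hτ.le_of_le (Nat.zero_le j) hj, hτ.2.2.1 ▸ hτ.le_of_le hj le_rfl⟩

theorem IsPartition.exists_mem_Icc {a b h : ℝ} {τ : ℕ → ℝ} {l : ℕ} (hτ : IsPartition a b τ l h)
    {t : ℝ} (ht : t ∈ Icc a b) : ∃ j < l, t ∈ Icc (τ j) (τ (j + 1)) := by
  have hl : ∃ k, t ≤ τ k := ⟨l, hτ.2.2.1 ▸ ht.2⟩
  classical
  rcases hk : Nat.find hl with _ | k
  · refine ⟨0, hτ.1, ?_, ?_⟩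
    · exact hτ.2.1 ▸ ht.1
    · have := Nat.find_spec hl
      rw [hk] at this
      exact this.trans (hτ.2.2.2.1 0 hτ.1).le
  · have h1 := Nat.find_spec hl
    have h2 := Nat.find_min hl (m := k) (by omega)
    have h3 : k + 1 ≤ l := hk ▸ Nat.find_min' hl (hτ.2.2.1 ▸ ht.2)
    rw [hk] at h1
    exact ⟨k, h3, (not_le.mp h2).le, h1⟩

/-- Velocities whose jumps are controlled by the half step sizes and whose mean square is bounded
are uniformly bounded. -/
theorem IsPartition.norm_velocity_le {E : Type*} [SeminormedAddCommGroup E] {a b h : ℝ}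
    {τ : ℕ → ℝ} {l : ℕ} (hτ : IsPartition a b τ l h) {v : ℕ → E} {G S : ℝ} (hG : 0 ≤ G)
    (hjump : ∀ j, j + 1 < l → ‖v (j + 1) - v j‖ ≤ G * ((τ (j + 2) - τ j) / 2))
    (hsum : ∑ j ∈ Finset.range l, ‖v j‖ ^ 2 * (τ (j + 1) - τ j) ≤ S * (b - a)) {j : ℕ}
    (hj : j < l) : ‖v j‖ ≤ √S + G * (b - a) := by
  have hbase : ∃ i ∈ Finset.range l, ‖v i‖ ^ 2 * (τ (i + 1) - τ i) ≤ S * (τ (i + 1) - τ i) := by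
    refine Finset.exists_le_of_sum_le ⟨0, Finset.mem_range.mpr hτ.1⟩ ?_
    rw [← Finset.mul_sum, Finset.sum_range_sub, hτ.2.1, hτ.2.2.1]
    exact hsum
  obtain ⟨i, hi, hvi⟩ := hbase
  rw [Finset.mem_range] at hi
  have hvi' : ‖v i‖ ≤ √S :=
    Real.le_sqrt_of_sq_le (le_of_mul_le_mul_right hvi (sub_pos.mpr (hτ.2.2.2.1 i hi)))
  have key : ∀ i j, i ≤ j → j < l →
      ‖v j - v i‖ ≤ G * ((τ (j + 1) + τ j) / 2 - (τ (i + 1) + τ i) / 2) := by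
    intro i j hij hj
    induction j, hij using Nat.le_induction with
    | base => simp
    | succ k _ ih =>
      have h1 := ih (by omega)
      have h2 := hjump k hj
      have h3 := norm_sub_le_norm_sub_add_norm_sub (v (k + 1)) (v k) (v i)
      have h4 : G * ((τ (k + 1 + 1) + τ (k + 1)) / 2 - (τ (i + 1) + τ i) / 2) =
        G * ((τ (k + 2) - τ k) / 2) + G * ((τ (k + 1) + τ k) / 2 - (τ (i + 1) + τ i) / 2) := by
        ring
      linarith
  have hdist : ‖v j - v i‖ ≤ G * (b - a) := by
    have b1 := hτ.mem_Icc hj.le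
    have b2 := hτ.mem_Icc (Nat.succ_le_of_lt hj)
    have b3 := hτ.mem_Icc hi.le
    have b4 := hτ.mem_Icc (Nat.succ_le_of_lt hi)
    simp only [Set.mem_Icc, Nat.succ_eq_add_one] at b1 b2 b3 b4
    rcases le_total i j with hij | hij
    · exact (key i j hij hj).trans (mul_le_mul_of_nonneg_left (by linarith) hG)
    · rw [norm_sub_rev]
      exact (key j i hij hi).trans (mul_le_mul_of_nonneg_left (by linarith) hG)
  have := norm_le_norm_add_norm_sub (v i) (v j)
  linarith [norm_sub_rev (v i) (v j)]

section DiscretePath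

variable {n : ℕ} {m a b R h : ℝ} {V : Eu n → ℝ} {τ : ℕ → ℝ} {l : ℕ} {γ : CPath a b n}

/-- The slope of a path on the `j`-th interval of a partition. -/
noncomputable def slopeAt (γ : CPath a b n) (τ : ℕ → ℝ) (j : ℕ) : Eu n :=
  (τ (j + 1) - τ j)⁻¹ • (pev γ (τ (j + 1)) - pev γ (τ j))

/-- The midpoint of the chord of a path on the `j`-th interval of a partition. -/
noncomputable def chordMid (γ : CPath a b n) (τ : ℕ → ℝ) (j : ℕ) : Eu n :=
  (2 : ℝ)⁻¹ • (pev γ (τ j) + pev γ (τ (j + 1)))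

/-- The acceleration field `-∇V / m` of Newton's equation. -/
noncomputable def accel (m : ℝ) (V : Eu n → ℝ) (x : Eu n) : Eu n := -(m⁻¹ • gradient V x)

theorem contDiff_accel (hV : ContDiff ℝ 2 V) : ContDiff ℝ 1 (accel m V) :=
  (hV.gradient_one.const_smul m⁻¹).neg

theorem eq_accel (hm : 0 < m) {x y : Eu n} (hxy : m • y = -gradient V x) : y = accel m V x := by
  rw [accel, ← smul_neg, ← hxy, inv_smul_smul₀ hm.ne']

theorem norm_pev_le (hR : 0 ≤ R) (hγ : ∀ t : Icc a b, ‖γ t‖ ≤ R) (t : ℝ) : ‖pev γ t‖ ≤ R := by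
  unfold pev
  split_ifs with ht
  · exact hγ ⟨t, ht⟩
  · simpa using hR

theorem norm_chordMid_le (hR : 0 ≤ R) (hγ : ∀ t : Icc a b, ‖γ t‖ ≤ R) (j : ℕ) :
    ‖chordMid γ τ j‖ ≤ R := by
  have h1 := norm_add_le_of_le (norm_pev_le hR hγ (τ j)) (norm_pev_le hR hγ (τ (j + 1)))
  rw [chordMid, norm_smul]
  norm_num
  linarith

theorem chordMid_eq {j : ℕ} (hτ : τ j < τ (j + 1)) : chordMid γ τ j =
    pev γ (τ j) + ((τ j + τ (j + 1)) / 2 - τ j) • slopeAt γ τ j := by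
  have h1 : ((τ j + τ (j + 1)) / 2 - τ j) * (τ (j + 1) - τ j)⁻¹ = 2⁻¹ := by
    field_simp [(sub_pos.mpr hτ).ne']
    ring
  rw [chordMid, slopeAt, smul_smul, h1]
  module

theorem PiecewiseAffine.pev_eq (hτ : IsPartition a b τ l h) (hγ : PiecewiseAffine a b τ l γ)
    {j : ℕ} (hj : j < l) {t : ℝ} (ht : t ∈ Icc (τ j) (τ (j + 1))) :
    pev γ t = pev γ (τ j) + (t - τ j) • slopeAt γ τ j := by
  have ht' : t ∈ Icc a b :=
    ⟨(hτ.mem_Icc hj.le).1.trans ht.1, ht.2.trans (hτ.mem_Icc (Nat.succ_le_of_lt hj)).2⟩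
  have h1 := hγ j hj ⟨t, ht'⟩ ht
  rw [slopeAt, smul_smul, ← div_eq_mul_inv, ← h1, pev, dif_pos ht']

theorem DiscreteEL.slopeAt_succ (hm : 0 < m) (hγ : DiscreteEL m V τ l γ) {j : ℕ}
    (hj : j + 1 < l) : slopeAt γ τ (j + 1) = slopeAt γ τ j +
      (((τ (j + 1) - τ j) / 2) • accel m V (chordMid γ τ j) +
        ((τ (j + 2) - τ (j + 1)) / 2) • accel m V (chordMid γ τ (j + 1))) := by
  have h1 := hγ (j + 1) (by omega) hj
  simp only [Nat.add_sub_cancel] at h1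
  change m • slopeAt γ τ j - m • slopeAt γ τ (j + 1) =
    ((τ (j + 1) - τ j) / 2) • gradient V (chordMid γ τ j) +
      ((τ (j + 2) - τ (j + 1)) / 2) • gradient V (chordMid γ τ (j + 1)) at h1
  rw [← smul_sub] at h1
  have h2 := congrArg (fun z => m⁻¹ • z) h1
  simp only [inv_smul_smul₀ hm.ne', smul_add, smul_comm m⁻¹] at h2
  simp only [accel, smul_neg, ← neg_add, ← h2]
  abel

/-- A bound on the discrete action bounds the mean square of the slopes. -/
theorem sum_norm_slopeAt_sq_le (hm : 0 < m) {c₂ C : ℝ} (hc₂ : 0 ≤ c₂)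
    (hV2 : ∀ x, |V x| ≤ c₂ * (1 + ‖x‖ ^ 2)) (hR : 0 ≤ R) (hτ : IsPartition a b τ l h)
    (hγ : ∀ t : Icc a b, ‖γ t‖ ≤ R) (hC : dActionSum m V τ l γ ≤ C) :
    ∑ j ∈ Finset.range l, ‖slopeAt γ τ j‖ ^ 2 * (τ (j + 1) - τ j) ≤
      2 / m * (C + c₂ * (1 + R ^ 2) * (b - a)) := by
  have h1 : ∑ j ∈ Finset.range l, (m / 2 * (‖slopeAt γ τ j‖ ^ 2 * (τ (j + 1) - τ j)) -
      c₂ * (1 + R ^ 2) * (τ (j + 1) - τ j)) ≤ dActionSum m V τ l γ := by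
    refine Finset.sum_le_sum fun j hj => ?_
    have hΔ : 0 < τ (j + 1) - τ j := sub_pos.mpr (hτ.2.2.2.1 j (Finset.mem_range.mp hj))
    have h2 : m / 2 * (‖slopeAt γ τ j‖ ^ 2 * (τ (j + 1) - τ j)) =
        m / 2 * ‖pev γ (τ (j + 1)) - pev γ (τ j)‖ ^ 2 / (τ (j + 1) - τ j) := by
      rw [slopeAt, norm_smul, norm_inv, Real.norm_of_nonneg hΔ.le]
      field_simp
    rw [h2]
    refine sub_le_sub_left (mul_le_mul_of_nonneg_right ?_ hΔ.le) _
    rw [add_comm (pev γ (τ (j + 1)))]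
    refine (le_abs_self _).trans ((hV2 _).trans ?_)
    have := norm_chordMid_le hR hγ (τ := τ) j
    rw [chordMid] at this
    gcongr
  rw [Finset.sum_sub_distrib, ← Finset.mul_sum, ← Finset.mul_sum, Finset.sum_range_sub, hτ.2.1,
    hτ.2.2.1] at h1
  rw [div_mul_eq_mul_div, le_div_iff₀ hm]
  linarith

theorem norm_slopeAt_le (hab : a < b) (hm : 0 < m) {c₂ C G : ℝ} (hc₂ : 0 ≤ c₂)
    (hV2 : ∀ x, |V x| ≤ c₂ * (1 + ‖x‖ ^ 2)) (hR : 0 ≤ R)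
    (hG : ∀ x, ‖x‖ ≤ R → ‖accel m V x‖ ≤ G) (hτ : IsPartition a b τ l h)
    (hγ : ∀ t : Icc a b, ‖γ t‖ ≤ R) (hEL : DiscreteEL m V τ l γ)
    (hC : dActionSum m V τ l γ ≤ C) {j : ℕ} (hj : j < l) :
    ‖slopeAt γ τ j‖ ≤
      √(2 / m * (C + c₂ * (1 + R ^ 2) * (b - a)) / (b - a)) + G * (b - a) := by
  have hacc : ∀ j, ‖accel m V (chordMid γ τ j)‖ ≤ G := fun j => hG _ (norm_chordMid_le hR hγ j)
  refine hτ.norm_velocity_le ((norm_nonneg _).trans (hacc 0)) (fun j hj => ?_) ?_ hj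
  · rw [hEL.slopeAt_succ hm hj, add_sub_cancel_left]
    have h0 : 0 < τ (j + 1) - τ j := sub_pos.mpr (hτ.2.2.2.1 j (by omega))
    have h1 : 0 < τ (j + 2) - τ (j + 1) := sub_pos.mpr (hτ.2.2.2.1 (j + 1) hj)
    refine (norm_add_le _ _).trans ?_
    rw [norm_smul, norm_smul, Real.norm_of_nonneg (by linarith), Real.norm_of_nonneg (by linarith)]
    have h2 := mul_le_mul_of_nonneg_left (hacc j) (half_pos h0).le
    have h3 := mul_le_mul_of_nonneg_left (hacc (j + 1)) (half_pos h1).le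
    linarith
  · rw [div_mul_cancel₀ _ (sub_pos.mpr hab).ne']
    exact sum_norm_slopeAt_sq_le hm hc₂ hV2 hR hτ hγ hC

/-- Comparison of a discrete extremal, lifted to phase space, with the solution of Newton's
equation having the same initial data, over the whole partition. -/
theorem dist_discrete_newton_le (hm : 0 < m) {S : Set (Eu n)} {L : ℝ≥0} {G M : ℝ}
    (hL : LipschitzOnWith L (accel m V) S) (hτ : IsPartition a b τ l h)
    (hpa : PiecewiseAffine a b τ l γ) (hEL : DiscreteEL m V τ l γ)
    (hγS : ∀ t ∈ Icc a b, pev γ t ∈ S) (hG : ∀ j, ‖accel m V (chordMid γ τ j)‖ ≤ G)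
    (hM : ∀ j < l, ‖slopeAt γ τ j‖ ≤ M) {f : ℝ → Eu n} (hf : ContDiff ℝ 2 f)
    (hN : ∀ t ∈ Icc a b, m • deriv (deriv f) t = -gradient V (f t))
    (hfS : ∀ t ∈ Icc a b, f t ∈ S) (hfa : f a = pev γ a) (hfa' : deriv f a = slopeAt γ τ 0)
    {j : ℕ} (hj : j < l) {t : ℝ} (ht : t ∈ Icc (τ j) (τ (j + 1))) :
    dist (pev γ t, slopeAt γ τ j + (t - (τ j + τ (j + 1)) / 2) • accel m V (chordMid γ τ j))
      (f t, deriv f t) ≤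
    gronwallBound ((G + L * M) * h) (max 1 L : ℝ≥0) ((G + L * M) * h) (t - a) := by
  have hK : ((max 1 L : ℝ≥0) : ℝ) ≠ 0 :=
    NNReal.coe_ne_zero.mpr (zero_lt_one.trans_le (le_max_left 1 L)).ne'
  have hG0 : 0 ≤ G := (norm_nonneg _).trans (hG 0)
  have hM0 : 0 ≤ M := (norm_nonneg _).trans (hM 0 hτ.1)
  have step : ∀ j < l, ∀ δ, dist (pev γ (τ j),
      slopeAt γ τ j + (τ j - (τ j + τ (j + 1)) / 2) • accel m V (chordMid γ τ j))
      (f (τ j), deriv f (τ j)) ≤ δ → ∀ t ∈ Icc (τ j) (τ (j + 1)),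
      dist (pev γ t, slopeAt γ τ j + (t - (τ j + τ (j + 1)) / 2) • accel m V (chordMid γ τ j))
        (f t, deriv f t) ≤ gronwallBound δ (max 1 L : ℝ≥0) ((G + L * M) * h) (t - τ j) := by
    intro j hj δ hδ t ht
    have hsub : ∀ t ∈ Icc (τ j) (τ (j + 1)), t ∈ Icc a b := fun t ht =>
      ⟨(hτ.mem_Icc hj.le).1.trans ht.1, ht.2.trans (hτ.mem_Icc (Nat.succ_le_of_lt hj)).2⟩
    have hlt := hτ.2.2.2.1 j hj
    rw [hpa.pev_eq hτ hj ht]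
    refine dist_midpoint_step_le hL hlt.le (hτ.2.2.2.2 j hj) (hM j hj) (hG j)
      (fun t ht => hpa.pev_eq hτ hj ht ▸ hγS t (hsub t ht)) (by rw [chordMid_eq hlt])
      (fun t _ => (hasDerivAt_deriv_deriv hf t).1) (fun t ht => ?_)
      (fun t ht => hfS t (hsub t ht)) hδ t ht
    rw [← eq_accel hm (hN t (hsub t ht))]
    exact (hasDerivAt_deriv_deriv hf t).2
  have node : ∀ j < l, dist (pev γ (τ j),
      slopeAt γ τ j + (τ j - (τ j + τ (j + 1)) / 2) • accel m V (chordMid γ τ j))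
      (f (τ j), deriv f (τ j)) ≤
      gronwallBound ((G + L * M) * h) (max 1 L : ℝ≥0) ((G + L * M) * h) (τ j - a) := by
    intro j
    induction j with
    | zero =>
      intro hj
      have h1 := hτ.2.2.2.1 0 hj
      have h2 := hτ.2.2.2.2 0 hj
      rw [zero_add] at h1 h2
      rw [hτ.2.1, sub_self, gronwallBound_x0, hfa, hfa', Prod.dist_eq, dist_self,
        dist_eq_norm, add_sub_cancel_left, norm_smul, zero_add]
      rw [hτ.2.1] at h1 h2
      have hh : 0 ≤ h := by linarith
      have h3 : ‖a - (a + τ 1) / 2‖ ≤ h := by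
        rw [Real.norm_eq_abs, abs_le]; constructor <;> linarith
      refine max_le (by positivity) ?_
      calc _ ≤ h * G := mul_le_mul h3 (hG 0) (norm_nonneg _) hh
        _ ≤ (G + L * M) * h := by
          have : 0 ≤ L * M * h := by positivity
          linarith
    | succ j ih =>
      intro hj
      have h1 := step j (by omega) _ (ih (by omega)) (τ (j + 1))
        ⟨(hτ.2.2.2.1 j (by omega)).le, le_rfl⟩
      rw [gronwallBound_gronwallBound hK, add_comm (τ j - a), sub_add_sub_cancel] at h1
      convert h1 using 3
      rw [hEL.slopeAt_succ hm hj]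
      module
  have h1 := step j hj _ (node j hj) t ht
  rwa [gronwallBound_gronwallBound hK, add_comm (τ j - a), sub_add_sub_cancel] at h1

end DiscretePath

/-- **Discrete stationary points shadow continuous extremals (Lemma 7.6).**
For all `R, C > 0` there are `c > 0` and `h₀ > 0` such that for every mesh `h ≤ h₀`, every
partition of `[a,b]` of mesh at most `h`, every piecewise affine solution `γ` of the
discrete Euler–Lagrange equations with `‖γ(t)‖ ≤ R` and `𝒜^{[h]}(γ) ≤ C`, and the `C²`
solution `f` of `mf'' = −∇V(f)` with `f(a) = γ(a)` and `f'(a) = (γ(τ₁) − γ(a))/(τ₁ − a)`,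
one has `‖γ(t) − f(t)‖ ≤ ch` on `[a,b]` and `‖γ'(t) − f'(t)‖ ≤ ch` in the interior of each
partition interval, where `γ'` is the slope of `γ` there. -/
theorem discrete_stationary_points_shadow_extremals
    {n : ℕ} (hn : 1 ≤ n) {a b : ℝ} (hab : a < b)
    (m : ℝ) (hm : 0 < m) (V : Eu n → ℝ) (hV1 : ContDiff ℝ (⊤ : ℕ∞) V)
    (c₂ : ℝ) (hc₂ : 0 < c₂) (hV2 : ∀ x : Eu n, |V x| ≤ c₂ * (1 + ‖x‖ ^ 2))
    (R C : ℝ) (hR : 0 < R) (hC : 0 < C) :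
    ∃ c : ℝ, 0 < c ∧ ∃ h₀ : ℝ, 0 < h₀ ∧
      ∀ h : ℝ, 0 < h → h ≤ h₀ → ∀ (l : ℕ) (τ : ℕ → ℝ), IsPartition a b τ l h →
        ∀ γ : CPath a b n, PiecewiseAffine a b τ l γ → DiscreteEL m V τ l γ →
          (∀ t : Set.Icc a b, ‖γ t‖ ≤ R) → dActionSum m V τ l γ ≤ C →
          ∀ f : ℝ → Eu n, ContDiff ℝ 2 f →
            (∀ t ∈ Set.Icc a b, m • deriv (deriv f) t = -gradient V (f t)) →
            f a = pev γ a → deriv f a = (τ 1 - a)⁻¹ • (pev γ (τ 1) - pev γ a) →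
            (∀ t ∈ Set.Icc a b, ‖pev γ t - f t‖ ≤ c * h) ∧
            ∀ j < l, ∀ t ∈ Set.Ioo (τ j) (τ (j + 1)),
              ‖(τ (j + 1) - τ j)⁻¹ • (pev γ (τ (j + 1)) - pev γ (τ j)) - deriv f t‖ ≤
                c * h := by
  have hVdiff : Differentiable ℝ V := hV1.differentiable (by simp)
  have hF : ContDiff ℝ 1 (accel m V) := contDiff_accel (contDiff_infty.mp hV1 2)
  obtain ⟨G, hG⟩ := (isCompact_closedBall (0 : Eu n) R).exists_bound_of_continuousOn
    hF.continuous.continuousOn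
  simp only [mem_closedBall_zero_iff] at hG
  have hG0 : 0 ≤ G := (norm_nonneg _).trans (hG 0 (by simpa using hR.le))
  have hba : 0 < b - a := sub_pos.mpr hab
  obtain ⟨M, hM⟩ : ∃ M, M = √(2 / m * (C + c₂ * (1 + R ^ 2) * (b - a)) / (b - a)) +
    G * (b - a) := ⟨_, rfl⟩
  have hM0 : 0 ≤ M := by rw [hM]; positivity
  obtain ⟨R', hR'⟩ : ∃ R', R' = max R (gronwallBound R √(2 / m * c₂)
    √(2 / m * (m / 2 * M ^ 2 + c₂ * (1 + R ^ 2) + c₂)) (b - a)) := ⟨_, rfl⟩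
  obtain ⟨L, hL⟩ := hF.locallyLipschitz.locallyLipschitzOn.exists_lipschitzOnWith_of_compact
    (isCompact_closedBall (0 : Eu n) R')
  have hK : 0 < ((max 1 L : ℝ≥0) : ℝ) :=
    NNReal.coe_pos.mpr (zero_lt_one.trans_le (le_max_left 1 L))
  have hB0 : 0 ≤ gronwallBound 1 (max 1 L : ℝ≥0) 1 (b - a) := by
    have h1 := gronwallBound_mono zero_le_one zero_le_one hK.le hba.le
    rw [gronwallBound_x0] at h1
    exact zero_le_one.trans h1
  refine ⟨(G + L * M) * gronwallBound 1 (max 1 L : ℝ≥0) 1 (b - a) + G + 1, by positivity, 1,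
    one_pos, ?_⟩
  intro h hh _ l τ hτ γ hpa hEL hγ hA f hf hN hfa hfa'
  have hfa'' : deriv f a = slopeAt γ τ 0 := by rw [hfa', slopeAt, hτ.2.1]
  have hslope : ∀ j < l, ‖slopeAt γ τ j‖ ≤ M := fun j hj =>
    hM ▸ norm_slopeAt_le hab hm hc₂.le hV2 hR.le hG hτ hγ hEL hA hj
  have hacc : ∀ j, ‖accel m V (chordMid γ τ j)‖ ≤ G :=
    fun j => hG _ (norm_chordMid_le hR.le hγ j)
  have hphase : ∀ j < l, ∀ t ∈ Set.Icc (τ j) (τ (j + 1)),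
      dist (pev γ t, slopeAt γ τ j +
        (t - (τ j + τ (j + 1)) / 2) • accel m V (chordMid γ τ j)) (f t, deriv f t) ≤
      (G + L * M) * gronwallBound 1 (max 1 L : ℝ≥0) 1 (b - a) * h := by
    intro j hj t ht
    have hta : a ≤ t := (hτ.mem_Icc hj.le).1.trans ht.1
    have htb : t ≤ b := ht.2.trans (hτ.mem_Icc (Nat.succ_le_of_lt hj)).2
    have h1 := dist_discrete_newton_le hm hL hτ hpa hEL
      (fun t _ => mem_closedBall_zero_iff.mpr
        ((norm_pev_le hR.le hγ t).trans (hR' ▸ le_max_left _ _))) hacc hslope hf hN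
      (fun t ht => mem_closedBall_zero_iff.mpr ((newton_norm_le hm hVdiff hc₂.le hV2 hf hN hR.le
        (hfa ▸ norm_pev_le hR.le hγ a) (hfa'' ▸ hslope 0 hτ.1) ht).trans
          (hR' ▸ le_max_right _ _))) hfa hfa'' hj ht
    have h2 : 0 ≤ (G + L * M) * h := by positivity
    refine h1.trans ((gronwallBound_mono h2 h2 hK.le (by linarith : t - a ≤ b - a)).trans ?_)
    have h3 := gronwallBound_mul ((G + L * M) * h) 1 (max 1 L : ℝ≥0) 1 (b - a)
    rw [mul_one] at h3
    rw [h3]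
    exact le_of_eq (by ring)
  constructor
  · intro t ht
    obtain ⟨j, hj, htj⟩ := hτ.exists_mem_Icc ht
    have h1 := (le_max_left _ _).trans (hphase j hj t htj)
    rw [dist_eq_norm] at h1
    refine h1.trans ?_
    gcongr
    linarith
  · intro j hj t ht
    have h1 := (le_max_right _ _).trans (hphase j hj t (Set.Ioo_subset_Icc_self ht))
    have h2 := hτ.2.2.2.2 j hj
    have h3 : ‖(t - (τ j + τ (j + 1)) / 2) • accel m V (chordMid γ τ j)‖ ≤ h * G := by
      rw [norm_smul, Real.norm_eq_abs]
      refine mul_le_mul (abs_le.mpr ?_) (hacc j) (norm_nonneg _) hh.le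
      constructor <;> linarith [ht.1, ht.2]
    rw [dist_eq_norm] at h1
    change ‖slopeAt γ τ j - deriv f t‖ ≤ _
    have h4 := norm_sub_le (slopeAt γ τ j +
      (t - (τ j + τ (j + 1)) / 2) • accel m V (chordMid γ τ j) - deriv f t)
      ((t - (τ j + τ (j + 1)) / 2) • accel m V (chordMid γ τ j))
    rw [sub_right_comm, add_sub_cancel_right] at h4
    linarith
end
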